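/- arXiv:1609.06284 — 2 statements merged into one kernel-verified Lean document; each statement's English description precedes it below -/
import Mathlib

section
/- There exist absolute constants c > 0 and C > 0 such that the following holds. Let F be a field and let A ⊆ F be a finite nonempty set. If F has positive characteristic p, assume |A| ≤ c · p^{5/8}. Then |A·(A+1)| ≥ C · |A|^{6/5}, where A·(A+1) = { a·(a'+1) : a, a' ∈ A }. -/
open scoped Classical Pointwise

namespace PointPlane

open MvPolynomial

variable {K : Type*} [Field K]

theorem totalDegree_pderiv_le {σ : Type*} (i : σ) (f : MvPolynomial σ K) :
    (pderiv i f).totalDegree ≤ f.totalDegree - 1 := by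
  refine Finset.sup_le fun m hm => ?_
  have h : coeff (m + Finsupp.single i 1) f ≠ 0 := by
    intro h
    rw [mem_support_iff, coeff_pderiv, h, zero_mul] at hm
    exact hm rfl
  have h2 := le_totalDegree (mem_support_iff.2 h)
  rw [Finsupp.sum_add_index' (by simp) (by simp), Finsupp.sum_single_index rfl] at h2
  omega

theorem totalDegree_pderiv_lt {σ : Type*} {i : σ} {f : MvPolynomial σ K}
    (h : pderiv i f ≠ 0) : (pderiv i f).totalDegree < f.totalDegree := by
  have h1 := totalDegree_pderiv_le i f
  rcases Nat.eq_zero_or_pos f.totalDegree with h0 | h0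
  · rw [totalDegree_eq_zero_iff_eq_C] at h0
    rw [h0, pderiv_C] at h
    exact absurd rfl h
  · omega

theorem pderiv_comm {σ : Type*} (i j : σ) (f : MvPolynomial σ K) :
    pderiv i (pderiv j f) = pderiv j (pderiv i f) := by
  have h : ⁅(pderiv i : Derivation K (MvPolynomial σ K) (MvPolynomial σ K)),
      (pderiv j : Derivation K (MvPolynomial σ K) (MvPolynomial σ K))⁆ = 0 := by
    refine derivation_ext fun k => ?_
    rw [Derivation.commutator_apply]
    by_cases h1 : k = i <;> by_cases h2 : k = j <;> simp [pderiv_X, Pi.single_apply, h1, h2]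
      <;> split_ifs <;> simp
  have h2 := congrArg (fun D => D f) h
  simpa [Derivation.commutator_apply, sub_eq_zero] using h2

theorem derivative_aeval {σ : Type*} [Fintype σ] (g : σ → Polynomial K) (f : MvPolynomial σ K) :
    Polynomial.derivative (aeval g f) =
      ∑ i, aeval g (pderiv i f) * Polynomial.derivative (g i) := by
  induction f using MvPolynomial.induction_on with
  | C a => simp
  | add p q hp hq => simp [hp, hq, add_mul, Finset.sum_add_distrib]
  | mul_X p j hp =>
    have h (i : σ) : aeval g (pderiv i (p * X j)) * Polynomial.derivative (g i)
        = (aeval g (pderiv i p) * Polynomial.derivative (g i)) * g j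
          + if j = i then aeval g p * Polynomial.derivative (g j) else 0 := by
      rw [pderiv_mul, pderiv_X, map_add, map_mul, map_mul, aeval_X, Pi.single_apply]
      split_ifs with hij
      · rw [hij, map_one]
        ring
      · rw [map_zero]
        ring
    rw [Finset.sum_congr rfl fun i _ => h i, Finset.sum_add_distrib, ← Finset.sum_mul, ← hp,
      Finset.sum_ite_eq, if_pos (Finset.mem_univ j), map_mul, aeval_X, Polynomial.derivative_mul]

/-- For `i < 2`, differentiation in the `i`-th coordinate along the level surfaces of `f`, with the
other of the first two coordinates held fixed, scaled by `∂₂ f`. -/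
noncomputable def levelDeriv (i : Fin 3) (f g : MvPolynomial (Fin 3) K) : MvPolynomial (Fin 3) K :=
  pderiv 2 f * pderiv i g - pderiv i f * pderiv 2 g

/-- On a surface `w = W(u, v)`, this is the numerator of `∂ᵢ∂ⱼ W`, up to sign. -/
noncomputable def hessianNum (i j : Fin 3) (f : MvPolynomial (Fin 3) K) :
    MvPolynomial (Fin 3) K :=
  pderiv 2 f * levelDeriv i f (pderiv j f) - pderiv j f * levelDeriv i f (pderiv 2 f)

theorem hessianNum_symmetry (f : MvPolynomial (Fin 3) K) :
    pderiv 2 f * levelDeriv 1 f (hessianNum 0 0 f)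
        - 3 * hessianNum 0 0 f * levelDeriv 1 f (pderiv 2 f)
      = pderiv 2 f * levelDeriv 0 f (hessianNum 0 1 f)
        - 3 * hessianNum 0 1 f * levelDeriv 0 f (pderiv 2 f) := by
  simp only [hessianNum, levelDeriv, map_sub, Derivation.leibniz, smul_eq_mul]
  simp only [pderiv_comm (1 : Fin 3) 0, pderiv_comm (2 : Fin 3) 0, pderiv_comm (2 : Fin 3) 1]
  ring

theorem totalDegree_levelDeriv_le (i : Fin 3) {f g : MvPolynomial (Fin 3) K} {d e : ℕ}
    (hf : f.totalDegree ≤ d) (hg : g.totalDegree ≤ e) :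
    (levelDeriv i f g).totalDegree ≤ d + e := by
  have h (j k : Fin 3) : (pderiv j f * pderiv k g).totalDegree ≤ d + e := by
    have := totalDegree_mul (pderiv j f) (pderiv k g)
    have := totalDegree_pderiv_le j f
    have := totalDegree_pderiv_le k g
    omega
  exact (totalDegree_sub _ _).trans (max_le (h _ _) (h _ _))

theorem totalDegree_hessianNum_le (i j : Fin 3) {f : MvPolynomial (Fin 3) K} {d : ℕ}
    (hf : f.totalDegree ≤ d) : (hessianNum i j f).totalDegree ≤ 3 * d := by
  have h1 (k : Fin 3) : (pderiv k f).totalDegree ≤ d :=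
    (totalDegree_pderiv_le k f).trans (by omega)
  have h (j k : Fin 3) : (pderiv j f * levelDeriv i f (pderiv k f)).totalDegree ≤ 3 * d := by
    have := totalDegree_mul (pderiv j f) (levelDeriv i f (pderiv k f))
    have := totalDegree_levelDeriv_le i hf (h1 k)
    have := h1 j
    omega
  exact (totalDegree_sub _ _).trans (max_le (h _ _) (h _ _))

theorem natDegree_eq_of_derivative_mul_eq {a b : Polynomial K} {E : ℕ}
    (hE : ∀ m : ℕ, 0 < m → m ≤ E → (m : K) ≠ 0) (ha : a ≠ 0) (hb : b ≠ 0)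
    (hda : a.natDegree ≤ E) (hdb : b.natDegree ≤ E)
    (h : Polynomial.derivative a * b = a * Polynomial.derivative b) :
    a.natDegree = b.natDegree := by
  have key : ((a.natDegree : K) - b.natDegree) = 0 := by
    have h1 := congrArg (fun p => Polynomial.coeff (Polynomial.X * p)
      (a.natDegree + b.natDegree)) h
    have h2 (p : Polynomial K) : (Polynomial.X * Polynomial.derivative p).natDegree ≤ p.natDegree ∧
        (Polynomial.X * Polynomial.derivative p).coeff p.natDegree
          = p.natDegree * p.leadingCoeff := by
      constructor
      · rcases Nat.eq_zero_or_pos p.natDegree with h0 | h0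
        · rw [Polynomial.derivative_of_natDegree_zero h0]
          simp
        · have := Polynomial.natDegree_derivative_le p
          have := Polynomial.natDegree_mul_le (p := Polynomial.X) (q := Polynomial.derivative p)
          have := Polynomial.natDegree_X_le (R := K)
          omega
      · rcases Nat.eq_zero_or_pos p.natDegree with h0 | h0
        · rw [h0]
          simp
        · obtain ⟨n, hn⟩ := Nat.exists_eq_succ_of_ne_zero h0.ne'
          rw [Polynomial.leadingCoeff, hn, Polynomial.coeff_X_mul, Polynomial.coeff_derivative]
          push_cast
          ring
    have h3 : Polynomial.X * (Polynomial.derivative a * b)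
        = (Polynomial.X * Polynomial.derivative a) * b := by ring
    have h4 : Polynomial.X * (a * Polynomial.derivative b)
        = a * (Polynomial.X * Polynomial.derivative b) := by ring
    simp only [h3, h4] at h1
    rw [Polynomial.coeff_mul_add_eq_of_natDegree_le (h2 a).1 le_rfl,
      Polynomial.coeff_mul_add_eq_of_natDegree_le le_rfl (h2 b).1, (h2 a).2, (h2 b).2] at h1
    have hla := Polynomial.leadingCoeff_ne_zero.2 ha
    have hlb := Polynomial.leadingCoeff_ne_zero.2 hb
    have : ((a.natDegree : K) - b.natDegree) * (a.leadingCoeff * b.leadingCoeff) = 0 := by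
      simp only [Polynomial.leadingCoeff] at h1 ⊢
      linear_combination h1
    exact (mul_eq_zero.1 this).resolve_right (mul_ne_zero hla hlb)
  by_contra hne
  rcases lt_or_gt_of_ne hne with hlt | hlt
  · refine hE (b.natDegree - a.natDegree) (by omega) (by omega) ?_
    rw [Nat.cast_sub hlt.le]
    linear_combination -key
  · refine hE (a.natDegree - b.natDegree) (by omega) (by omega) ?_
    rw [Nat.cast_sub hlt.le]
    linear_combination key

theorem exists_eq_C_mul_of_derivative_mul_eq {a b : Polynomial K} {E : ℕ}
    (hE : ∀ m : ℕ, 0 < m → m ≤ E → (m : K) ≠ 0) (hb : b ≠ 0)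
    (hda : a.natDegree ≤ E) (hdb : b.natDegree ≤ E)
    (h : Polynomial.derivative a * b = a * Polynomial.derivative b) :
    ∃ c : K, a = Polynomial.C c * b := by
  by_cases ha : a = 0
  · exact ⟨0, by simp [ha]⟩
  have hdeg := natDegree_eq_of_derivative_mul_eq hE ha hb hda hdb h
  have hlb := Polynomial.leadingCoeff_ne_zero.2 hb
  refine ⟨a.leadingCoeff / b.leadingCoeff, ?_⟩
  by_contra hne
  set c := a.leadingCoeff / b.leadingCoeff with hc
  have hr : a - Polynomial.C c * b ≠ 0 := sub_ne_zero.2 hne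
  have hle : (a - Polynomial.C c * b).natDegree ≤ b.natDegree := by
    refine (Polynomial.natDegree_sub_le _ _).trans (max_le hdeg.le ?_)
    exact Polynomial.natDegree_C_mul_le _ _
  have hdr := natDegree_eq_of_derivative_mul_eq hE hr hb (hle.trans hdb) hdb (by
    simp only [Polynomial.derivative_sub, Polynomial.derivative_C_mul]
    linear_combination h)
  refine hr (Polynomial.leadingCoeff_eq_zero.1 ?_)
  rw [Polynomial.leadingCoeff, hdr, Polynomial.coeff_sub, Polynomial.coeff_C_mul]
  have h1 : a.coeff b.natDegree = a.leadingCoeff := by rw [← hdeg]; rfl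
  have h2 : b.coeff b.natDegree = b.leadingCoeff := rfl
  rw [h1, h2, hc, div_mul_cancel₀ _ hlb, sub_self]

theorem eval_aeval_polynomial {σ : Type*} (g : σ → Polynomial K) (f : MvPolynomial σ K) (z : K) :
    (aeval g f : Polynomial K).eval z = eval (fun i => (g i).eval z) f := by
  induction f using MvPolynomial.induction_on with
  | C a => simp
  | add p q hp hq => simp [hp, hq]
  | mul_X p j hp => simp [hp]

/-- Restriction of a polynomial to the line `{(x, v, s v + t)}`, where `ℓ = (x, s, t)`. -/
noncomputable def onRed (ℓ : K × K × K) : MvPolynomial (Fin 3) K →ₐ[K] Polynomial K :=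
  aeval ![Polynomial.C ℓ.1, Polynomial.X,
    Polynomial.C ℓ.2.1 * Polynomial.X + Polynomial.C ℓ.2.2]

/-- Restriction of a polynomial to the line `{(u, y, σ u + τ)}`, where `m = (y, σ, τ)`. -/
noncomputable def onBlue (m : K × K × K) : MvPolynomial (Fin 3) K →ₐ[K] Polynomial K :=
  aeval ![Polynomial.X, Polynomial.C m.1,
    Polynomial.C m.2.1 * Polynomial.X + Polynomial.C m.2.2]

/-- The lines `{(x, v, s v + t)}` and `{(u, y, σ u + τ)}` meet. -/
def Meets (ℓ m : K × K × K) : Prop :=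
  ℓ.2.1 * m.1 + ℓ.2.2 = m.2.1 * ℓ.1 + m.2.2

theorem eval_onRed_eq_eval_onBlue {ℓ m : K × K × K} (h : Meets ℓ m)
    (f : MvPolynomial (Fin 3) K) : (onRed ℓ f).eval m.1 = (onBlue m f).eval ℓ.1 := by
  rw [onRed, onBlue, eval_aeval_polynomial, eval_aeval_polynomial]
  congr 2
  funext i
  fin_cases i
  · simp
  · simp
  · simpa [Meets] using h

theorem derivative_onRed (ℓ : K × K × K) (f : MvPolynomial (Fin 3) K) :
    Polynomial.derivative (onRed ℓ f)
      = onRed ℓ (pderiv 1 f) + Polynomial.C ℓ.2.1 * onRed ℓ (pderiv 2 f) := by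
  rw [onRed, derivative_aeval, Fin.sum_univ_three]
  simp
  ring

theorem derivative_onBlue (m : K × K × K) (f : MvPolynomial (Fin 3) K) :
    Polynomial.derivative (onBlue m f)
      = onBlue m (pderiv 0 f) + Polynomial.C m.2.1 * onBlue m (pderiv 2 f) := by
  rw [onBlue, derivative_aeval, Fin.sum_univ_three]
  simp
  ring

theorem onRed_pderiv_one {ℓ : K × K × K} {f : MvPolynomial (Fin 3) K} (h : onRed ℓ f = 0) :
    onRed ℓ (pderiv 1 f) = -(Polynomial.C ℓ.2.1 * onRed ℓ (pderiv 2 f)) := by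
  have := derivative_onRed ℓ f
  rw [h, Polynomial.derivative_zero] at this
  linear_combination -this

theorem onBlue_pderiv_zero {m : K × K × K} {f : MvPolynomial (Fin 3) K} (h : onBlue m f = 0) :
    onBlue m (pderiv 0 f) = -(Polynomial.C m.2.1 * onBlue m (pderiv 2 f)) := by
  have := derivative_onBlue m f
  rw [h, Polynomial.derivative_zero] at this
  linear_combination -this

theorem onRed_levelDeriv {ℓ : K × K × K} {f : MvPolynomial (Fin 3) K} (h : onRed ℓ f = 0)
    (g : MvPolynomial (Fin 3) K) : onRed ℓ (levelDeriv 1 f g)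
      = onRed ℓ (pderiv 2 f) * Polynomial.derivative (onRed ℓ g) := by
  rw [levelDeriv, map_sub, map_mul, map_mul, onRed_pderiv_one h, derivative_onRed]
  ring

theorem onBlue_levelDeriv {m : K × K × K} {f : MvPolynomial (Fin 3) K} (h : onBlue m f = 0)
    (g : MvPolynomial (Fin 3) K) : onBlue m (levelDeriv 0 f g)
      = onBlue m (pderiv 2 f) * Polynomial.derivative (onBlue m g) := by
  rw [levelDeriv, map_sub, map_mul, map_mul, onBlue_pderiv_zero h, derivative_onBlue]
  ring

theorem onBlue_hessianNum {m : K × K × K} {f : MvPolynomial (Fin 3) K} (h : onBlue m f = 0) :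
    onBlue m (hessianNum 0 0 f) = 0 := by
  rw [hessianNum, map_sub, map_mul, map_mul, onBlue_levelDeriv h, onBlue_levelDeriv h,
    onBlue_pderiv_zero h, Polynomial.derivative_neg, Polynomial.derivative_C_mul]
  ring

theorem natDegree_onRed_le (ℓ : K × K × K) (f : MvPolynomial (Fin 3) K) :
    (onRed ℓ f).natDegree ≤ f.totalDegree := by
  refine (aeval_natDegree_le f le_rfl _ (n := 1) fun i => ?_).trans_eq (mul_one _)
  fin_cases i
  · simp
  · simp
  · exact Polynomial.natDegree_linear_le

theorem natDegree_onBlue_le (m : K × K × K) (f : MvPolynomial (Fin 3) K) :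
    (onBlue m f).natDegree ≤ f.totalDegree := by
  refine (aeval_natDegree_le f le_rfl _ (n := 1) fun i => ?_).trans_eq (mul_one _)
  fin_cases i
  · simp
  · simp
  · exact Polynomial.natDegree_linear_le

/-- A surface of degree at most `3 * n` through fewer than `n ^ 2 / 3` lines. -/
theorem exists_vanishing_onRed (R : Finset (K × K × K)) {n : ℕ} (hn : 3 * R.card < n ^ 2) :
    ∃ f : MvPolynomial (Fin 3) K, f ≠ 0 ∧ f.totalDegree ≤ 3 * n ∧ ∀ ℓ ∈ R, onRed ℓ f = 0 := by
  have hn0 : 0 < n := by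
    rcases Nat.eq_zero_or_pos n with rfl | h
    · simp at hn
    · exact h
  let e : (Fin 3 → Fin n) → (Fin 3 →₀ ℕ) := fun a => Finsupp.equivFunOnFinite.symm fun i => a i
  have he : Function.Injective e := by
    intro a b hab
    funext i
    have := DFunLike.congr_fun hab i
    exact Fin.ext this
  let poly : ((Fin 3 → Fin n) → K) →ₗ[K] MvPolynomial (Fin 3) K :=
    ∑ a, (monomial (e a)).comp (LinearMap.proj a)
  have hpoly (c : (Fin 3 → Fin n) → K) : poly c = ∑ a, monomial (e a) (c a) := by
    simp [poly, LinearMap.sum_apply]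
  have hdeg (c) : (poly c).totalDegree ≤ 3 * n - 1 := by
    rw [hpoly]
    refine totalDegree_finsetSum_le fun a _ => (totalDegree_monomial_le _ _).trans ?_
    rw [Finsupp.sum_fintype _ _ (fun _ => rfl), Fin.sum_univ_three]
    change e a 0 + e a 1 + e a 2 ≤ 3 * n - 1
    have h0 : e a 0 = a 0 := rfl
    have h1 : e a 1 = a 1 := rfl
    have h2 : e a 2 = a 2 := rfl
    have := (a 0).2
    have := (a 1).2
    have := (a 2).2
    omega
  let Φ : ((Fin 3 → Fin n) → K) →ₗ[K] (R × Fin (3 * n) → K) :=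
    LinearMap.pi fun p => (Polynomial.lcoeff K p.2).comp ((onRed p.1.1).toLinearMap.comp poly)
  have hker : LinearMap.ker Φ ≠ ⊥ := by
    refine LinearMap.ker_ne_bot_of_finrank_lt ?_
    simp only [Module.finrank_fintype_fun_eq_card, Fintype.card_prod, Fintype.card_fin,
      Fintype.card_coe, Fintype.card_fun]
    calc R.card * (3 * n) = 3 * R.card * n := by ring
      _ < n ^ 2 * n := Nat.mul_lt_mul_of_pos_right hn hn0
      _ = n ^ 3 := by ring
  obtain ⟨c, hc, hc0⟩ := Submodule.exists_mem_ne_zero_of_ne_bot hker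
  refine ⟨poly c, ?_, (hdeg c).trans (by omega), fun ℓ hℓ => ?_⟩
  · intro h0
    apply hc0
    funext a
    have := congrArg (coeff (e a)) h0
    rw [hpoly, coeff_sum] at this
    simpa [coeff_monomial, he.eq_iff] using this
  · ext k
    rw [Polynomial.coeff_zero]
    by_cases hk : k < 3 * n
    · exact congrFun (LinearMap.mem_ker.1 hc) (⟨ℓ, hℓ⟩, ⟨k, hk⟩)
    · refine Polynomial.coeff_eq_zero_of_natDegree_lt ?_
      have := natDegree_onRed_le ℓ (poly c)
      have := hdeg c
      omega

theorem eval_eq_eval_of_pderiv_eq_zero {f : MvPolynomial (Fin 3) K}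
    (hE : ∀ m : ℕ, 0 < m → m ≤ f.totalDegree → (m : K) ≠ 0) (hf : pderiv 2 f = 0)
    (u v w w' : K) : eval ![u, v, w] f = eval ![u, v, w'] f := by
  let g : Fin 3 → Polynomial K := ![Polynomial.C u, Polynomial.C v, Polynomial.X]
  have hg (z : K) : (aeval g f : Polynomial K).eval z = eval ![u, v, z] f := by
    rw [eval_aeval_polynomial]
    congr 2
    funext i
    fin_cases i <;> simp [g]
  have hd : Polynomial.derivative (aeval g f) = 0 := by
    rw [derivative_aeval, Fin.sum_univ_three]
    simp [g, hf]
  have hdeg : (aeval g f : Polynomial K).natDegree ≤ f.totalDegree := by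
    refine (aeval_natDegree_le f le_rfl _ (n := 1) fun i => ?_).trans_eq (mul_one _)
    fin_cases i <;> simp [g]
  obtain ⟨c, hc⟩ := exists_eq_C_mul_of_derivative_mul_eq (b := 1) hE one_ne_zero hdeg
    (by simp) (by simp [hd])
  rw [← hg, ← hg, hc]
  simp

theorem onRed_eq_zero_of_onBlue {R B : Finset (K × K × K)} {L : ℕ}
    (hB : Set.InjOn Prod.fst (B : Set (K × K × K)))
    (hRL : ∀ ℓ ∈ R, L ≤ (B.filter fun m => Meets ℓ m).card)
    {g : MvPolynomial (Fin 3) K} (hg : g.totalDegree < L) (h : ∀ m ∈ B, onBlue m g = 0) :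
    ∀ ℓ ∈ R, onRed ℓ g = 0 := by
  intro ℓ hℓ
  refine Polynomial.eq_zero_of_natDegree_lt_card_of_eval_eq_zero' _
    ((B.filter fun m => Meets ℓ m).image Prod.fst) ?_ ?_
  · intro y hy
    obtain ⟨m, hm, rfl⟩ := Finset.mem_image.1 hy
    rw [Finset.mem_filter] at hm
    rw [eval_onRed_eq_eval_onBlue hm.2, h m hm.1, Polynomial.eval_zero]
  · rw [Finset.card_image_of_injOn (hB.mono (Finset.coe_subset.2 (Finset.filter_subset _ _)))]
    exact ((natDegree_onRed_le ℓ g).trans_lt hg).trans_le (hRL ℓ hℓ)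

theorem onBlue_eq_zero_of_onRed {R B : Finset (K × K × K)} {L : ℕ}
    (hR : Set.InjOn Prod.fst (R : Set (K × K × K)))
    (hBL : ∀ m ∈ B, L ≤ (R.filter fun ℓ => Meets ℓ m).card)
    {g : MvPolynomial (Fin 3) K} (hg : g.totalDegree < L) (h : ∀ ℓ ∈ R, onRed ℓ g = 0) :
    ∀ m ∈ B, onBlue m g = 0 := by
  intro m hm
  refine Polynomial.eq_zero_of_natDegree_lt_card_of_eval_eq_zero' _
    ((R.filter fun ℓ => Meets ℓ m).image Prod.fst) ?_ ?_
  · intro x hx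
    obtain ⟨ℓ, hℓ, rfl⟩ := Finset.mem_image.1 hx
    rw [Finset.mem_filter] at hℓ
    rw [← eval_onRed_eq_eval_onBlue hℓ.2, h ℓ hℓ.1, Polynomial.eval_zero]
  · rw [Finset.card_image_of_injOn (hR.mono (Finset.coe_subset.2 (Finset.filter_subset _ _)))]
    exact ((natDegree_onBlue_le m g).trans_lt hg).trans_le (hBL m hm)

/-- If the second derivative of `a / b` vanishes, in the sense of the hypothesis `h` with
`Q = (a / b)' b ^ 2`, then `a / b` is affine. -/
theorem eq_linear_mul_of_derivative {a b Q : Polynomial K} {d : ℕ}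
    (hE : ∀ m : ℕ, 0 < m → m ≤ 2 * d + 1 → (m : K) ≠ 0) (hb : b ≠ 0)
    (hda : a.natDegree ≤ d) (hdb : b.natDegree ≤ d)
    (hQ : Q = b * Polynomial.derivative a - a * Polynomial.derivative b)
    (h : b * Polynomial.derivative (b * Q) = 3 * (b * Q) * Polynomial.derivative b) :
    ∃ c e : K, a = (Polynomial.C c * Polynomial.X + Polynomial.C e) * b := by
  have hQ' : Polynomial.derivative Q * b ^ 2 = Q * Polynomial.derivative (b ^ 2) := by
    apply mul_left_cancel₀ hb
    simp only [Polynomial.derivative_mul, pow_two] at h ⊢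
    linear_combination b * h
  have hQd : Q.natDegree ≤ 2 * d + 1 := by
    have h1 := Polynomial.natDegree_derivative_le a
    have h2 := Polynomial.natDegree_derivative_le b
    have h3 := Polynomial.natDegree_mul_le (p := b) (q := Polynomial.derivative a)
    have h4 := Polynomial.natDegree_mul_le (p := a) (q := Polynomial.derivative b)
    have h5 := Polynomial.natDegree_sub_le (b * Polynomial.derivative a)
      (a * Polynomial.derivative b)
    rw [hQ]
    omega
  obtain ⟨c, hc⟩ := exists_eq_C_mul_of_derivative_mul_eq hE (pow_ne_zero 2 hb) hQd
    (Polynomial.natDegree_pow_le.trans (by omega)) hQ'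
  have had : (a - Polynomial.C c * Polynomial.X * b).natDegree ≤ 2 * d + 1 := by
    have h1 := Polynomial.natDegree_mul_le (p := Polynomial.C c * Polynomial.X) (q := b)
    have h2 := Polynomial.natDegree_linear_le (a := c) (b := 0)
    rw [Polynomial.C_0, add_zero] at h2
    have h3 := Polynomial.natDegree_sub_le a (Polynomial.C c * Polynomial.X * b)
    omega
  obtain ⟨e, he⟩ := exists_eq_C_mul_of_derivative_mul_eq hE hb had (by omega) (by
    simp only [Polynomial.derivative_sub, Polynomial.derivative_mul, Polynomial.derivative_C,
      Polynomial.derivative_X]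
    linear_combination hc - hQ)
  exact ⟨c, e, by linear_combination he⟩

theorem not_forall_many_meets [Infinite K] {R B : Finset (K × K × K)} {n k L : ℕ}
    (hR : Set.InjOn Prod.fst (R : Set (K × K × K)))
    (hB : Set.InjOn Prod.fst (B : Set (K × K × K)))
    (hn : 3 * R.card < n ^ 2) (hE : ∀ m : ℕ, 0 < m → m ≤ 6 * n + 1 → (m : K) ≠ 0)
    (hk : ∀ m ∈ B, ∀ α β : K,
      (R.filter fun ℓ => Meets ℓ m ∧ ℓ.2.1 = α * ℓ.1 + β).card ≤ k)
    (hL : 12 * n + k < L) (hne : R.Nonempty)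
    (hRL : ∀ ℓ ∈ R, L ≤ (B.filter fun m => Meets ℓ m).card)
    (hBL : ∀ m ∈ B, L ≤ (R.filter fun ℓ => Meets ℓ m).card) : False := by
  obtain ⟨f, ⟨hf0, hfR⟩, hfmin⟩ := exists_minimalFor_of_wellFoundedLT
    (fun f : MvPolynomial (Fin 3) K => f ≠ 0 ∧ ∀ ℓ ∈ R, onRed ℓ f = 0) totalDegree
    (by
      obtain ⟨f, h1, -, h2⟩ := exists_vanishing_onRed R hn
      exact ⟨f, h1, h2⟩)
  have hfd : f.totalDegree ≤ 3 * n := by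
    obtain ⟨g, h1, h2, h3⟩ := exists_vanishing_onRed R hn
    by_contra hlt
    have := hfmin ⟨h1, h3⟩ (by omega)
    omega
  have hB2R : ∀ {g : MvPolynomial (Fin 3) K}, g.totalDegree < L →
      (∀ m ∈ B, onBlue m g = 0) → ∀ ℓ ∈ R, onRed ℓ g = 0 :=
    fun hg h => onRed_eq_zero_of_onBlue hB hRL hg h
  have hR2B : ∀ {g : MvPolynomial (Fin 3) K}, g.totalDegree < L →
      (∀ ℓ ∈ R, onRed ℓ g = 0) → ∀ m ∈ B, onBlue m g = 0 :=
    fun hg h => onBlue_eq_zero_of_onRed hR hBL hg h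
  have hfB := hR2B (g := f) (by omega) hfR
  have hHd := totalDegree_hessianNum_le 0 0 hfd
  have hHR := hB2R (g := hessianNum 0 0 f) (by omega) fun m hm => onBlue_hessianNum (hfB m hm)
  have hDB := hR2B (g := levelDeriv 1 f (hessianNum 0 0 f))
    (by have := totalDegree_levelDeriv_le 1 hfd hHd; omega)
    fun ℓ hℓ => by rw [onRed_levelDeriv (hfR ℓ hℓ), hHR ℓ hℓ, Polynomial.derivative_zero, mul_zero]
  by_cases hw : ∀ m ∈ B, onBlue m (pderiv 2 f) = 0
  · have hf2 : pderiv 2 f = 0 := by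
      by_contra hne0
      have hlt := totalDegree_pderiv_lt hne0
      have := hfmin ⟨hne0, hB2R (by omega) hw⟩ hlt.le
      omega
    obtain ⟨z, hz⟩ : ∃ z, eval z f ≠ 0 := by
      by_contra! h
      exact hf0 (MvPolynomial.funext fun z => by rw [h z, map_zero])
    let g : Polynomial K := aeval ![Polynomial.X, Polynomial.C (z 1), Polynomial.C (z 2)] f
    have hg (u : K) : g.eval u = eval ![u, z 1, z 2] f := by
      rw [eval_aeval_polynomial]
      congr 2
      funext i
      fin_cases i <;> simp
    have hgd : g.natDegree ≤ f.totalDegree := by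
      refine (aeval_natDegree_le f le_rfl _ (n := 1) fun i => ?_).trans_eq (mul_one _)
      fin_cases i <;> simp
    have hg0 : g = 0 := by
      refine Polynomial.eq_zero_of_natDegree_lt_card_of_eval_eq_zero' _ (R.image Prod.fst) ?_ ?_
      · intro x hx
        obtain ⟨ℓ, hℓ, rfl⟩ := Finset.mem_image.1 hx
        rw [hg, eval_eq_eval_of_pderiv_eq_zero (fun m h1 h2 => hE m h1 (by omega)) hf2 _ _ _
          (ℓ.2.1 * z 1 + ℓ.2.2)]
        have := congrArg (Polynomial.eval (z 1)) (hfR ℓ hℓ)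
        rw [onRed, eval_aeval_polynomial, Polynomial.eval_zero] at this
        rw [← this]
        congr 2
        funext i
        fin_cases i <;> simp
      · rw [Finset.card_image_of_injOn hR]
        obtain ⟨ℓ, hℓ⟩ := hne
        obtain ⟨m, hm⟩ : (B.filter fun m => Meets ℓ m).Nonempty := by
          rw [← Finset.card_pos]
          exact lt_of_lt_of_le (by omega) (hRL ℓ hℓ)
        have := hBL m (Finset.mem_filter.1 hm).1
        have := Finset.card_filter_le R fun ℓ => Meets ℓ m
        omega
    apply hz
    have := hg (z 0)
    rw [hg0, Polynomial.eval_zero] at this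
    rw [this]
    congr 2
    funext i
    fin_cases i <;> simp
  · push Not at hw
    obtain ⟨m, hm, hb⟩ := hw
    set a := onBlue m (pderiv 1 f) with ha
    set b := onBlue m (pderiv 2 f) with hb'
    have hd1 := totalDegree_pderiv_le 1 f
    have hd2 := totalDegree_pderiv_le 2 f
    have had : a.natDegree ≤ 3 * n := (natDegree_onBlue_le m _).trans (by omega)
    have hbd : b.natDegree ≤ 3 * n := (natDegree_onBlue_le m _).trans (by omega)
    have hsym := congrArg (onBlue m) (hessianNum_symmetry f)
    have hP : onBlue m (hessianNum 0 1 f)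
        = b * (b * Polynomial.derivative a - a * Polynomial.derivative b) := by
      rw [hessianNum, map_sub, map_mul, map_mul, onBlue_levelDeriv (hfB m hm),
        onBlue_levelDeriv (hfB m hm)]
      ring
    rw [map_sub, map_sub, map_mul, map_mul, map_mul, map_mul, map_mul, map_mul, hDB m hm,
      onBlue_hessianNum (hfB m hm), onBlue_levelDeriv (hfB m hm), onBlue_levelDeriv (hfB m hm),
      hP, map_ofNat] at hsym
    obtain ⟨c, e, hce⟩ := eq_linear_mul_of_derivative (d := 3 * n)
      (fun m h1 h2 => hE m h1 (by omega)) hb had hbd rfl (by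
        apply mul_left_cancel₀ hb
        linear_combination -hsym)
    have hsub : (R.filter fun ℓ => Meets ℓ m) ⊆
        (R.filter fun ℓ => Meets ℓ m ∧ ℓ.2.1 = -c * ℓ.1 + -e) ∪
          R.filter fun ℓ => b.eval ℓ.1 = 0 := by
      intro ℓ hℓ
      obtain ⟨hℓR, hmeet⟩ := Finset.mem_filter.1 hℓ
      rw [Finset.mem_union, Finset.mem_filter, Finset.mem_filter]
      by_cases hbx : b.eval ℓ.1 = 0
      · exact Or.inr ⟨hℓR, hbx⟩
      refine Or.inl ⟨hℓR, hmeet, ?_⟩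
      have h1 := congrArg (Polynomial.eval m.1) (onRed_pderiv_one (hfR ℓ hℓR))
      rw [Polynomial.eval_neg, Polynomial.eval_mul, eval_onRed_eq_eval_onBlue hmeet,
        eval_onRed_eq_eval_onBlue hmeet, ← ha, ← hb', hce] at h1
      simp only [Polynomial.eval_mul, Polynomial.eval_add, Polynomial.eval_C,
        Polynomial.eval_X] at h1
      apply mul_right_cancel₀ hbx
      linear_combination h1
    have hroots : (R.filter fun ℓ => b.eval ℓ.1 = 0).card ≤ 3 * n := by
      rw [← Finset.card_image_of_injOn (f := Prod.fst) (hR.mono (Finset.coe_subset.2 (Finset.filter_subset _ _)))]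
      by_contra! hlt
      refine hb (Polynomial.eq_zero_of_natDegree_lt_card_of_eval_eq_zero' _ _ ?_
        (hbd.trans_lt hlt))
      intro x hx
      obtain ⟨ℓ, hℓ, rfl⟩ := Finset.mem_image.1 hx
      exact (Finset.mem_filter.1 hℓ).2
    have h1 := Finset.card_le_card hsub
    have h2 := Finset.card_union_le (R.filter fun ℓ => Meets ℓ m ∧ ℓ.2.1 = -c * ℓ.1 + -e)
      (R.filter fun ℓ => b.eval ℓ.1 = 0)
    have h3 := hk m hm (-c) (-e)
    have h4 := hBL m hm
    omega

/-- The number of pairs of meeting lines. -/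
noncomputable def meetCount (R B : Finset (K × K × K)) : ℕ :=
  ((R ×ˢ B).filter fun q => Meets q.1 q.2).card

theorem meetCount_le_erase_left (R B : Finset (K × K × K)) (ℓ : K × K × K) :
    meetCount R B ≤ meetCount (R.erase ℓ) B + (B.filter fun m => Meets ℓ m).card := by
  rw [meetCount, meetCount, ← Finset.card_image_of_injective (B.filter fun m => Meets ℓ m)
    (Prod.mk_right_injective ℓ)]
  refine (Finset.card_le_card ?_).trans (Finset.card_union_le _ _)
  rintro ⟨a, b⟩ h
  simp only [Finset.mem_filter, Finset.mem_product, Finset.mem_union, Finset.mem_erase,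
    Finset.mem_image, Prod.mk.injEq] at h ⊢
  by_cases hal : a = ℓ
  · subst hal
    exact Or.inr ⟨b, ⟨h.1.2, h.2⟩, rfl, rfl⟩
  · exact Or.inl ⟨⟨⟨hal, h.1.1⟩, h.1.2⟩, h.2⟩

theorem meetCount_le_erase_right (R B : Finset (K × K × K)) (m : K × K × K) :
    meetCount R B ≤ meetCount R (B.erase m) + (R.filter fun ℓ => Meets ℓ m).card := by
  rw [meetCount, meetCount, ← Finset.card_image_of_injective (R.filter fun ℓ => Meets ℓ m)
    (Prod.mk_left_injective m)]
  refine (Finset.card_le_card ?_).trans (Finset.card_union_le _ _)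
  rintro ⟨a, b⟩ h
  simp only [Finset.mem_filter, Finset.mem_product, Finset.mem_union, Finset.mem_erase,
    Finset.mem_image, Prod.mk.injEq] at h ⊢
  by_cases hal : b = m
  · subst hal
    exact Or.inr ⟨a, ⟨h.1.1, h.2⟩, rfl, rfl⟩
  · exact Or.inl ⟨⟨h.1.1, hal, h.1.2⟩, h.2⟩

theorem meetCount_le_of_injOn [Infinite K] {n k : ℕ}
    (hE : ∀ m : ℕ, 0 < m → m ≤ 6 * n + 1 → (m : K) ≠ 0) (N : ℕ) :
    ∀ R B : Finset (K × K × K), R.card + B.card = N →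
    Set.InjOn Prod.fst (R : Set (K × K × K)) → Set.InjOn Prod.fst (B : Set (K × K × K)) →
    3 * R.card < n ^ 2 →
    (∀ m ∈ B, ∀ α β : K,
      (R.filter fun ℓ => Meets ℓ m ∧ ℓ.2.1 = α * ℓ.1 + β).card ≤ k) →
    meetCount R B ≤ (12 * n + k + 1) * N := by
  induction N with
  | zero =>
    intro R B hN _ _ _ _
    have : R = ∅ := Finset.card_eq_zero.1 (by omega)
    simp [meetCount, this]
  | succ N ih =>
    intro R B hN hR hB hn hk
    rcases R.eq_empty_or_nonempty with rfl | hne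
    · simp [meetCount]
    by_cases h1 : ∃ ℓ ∈ R, (B.filter fun m => Meets ℓ m).card < 12 * n + k + 1
    · obtain ⟨ℓ, hℓ, hlt⟩ := h1
      have hc := Finset.card_erase_of_mem hℓ
      have hpos := Finset.card_pos.2 ⟨ℓ, hℓ⟩
      have hsub := Finset.erase_subset ℓ R
      have := ih (R.erase ℓ) B (by omega) (hR.mono (Finset.coe_subset.2 hsub)) hB (by omega)
        fun m hm α β => (Finset.card_le_card (Finset.filter_subset_filter _ hsub)).trans
          (hk m hm α β)
      have := meetCount_le_erase_left R B ℓ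
      rw [mul_add_one]
      omega
    by_cases h2 : ∃ m ∈ B, (R.filter fun ℓ => Meets ℓ m).card < 12 * n + k + 1
    · obtain ⟨m, hm, hlt⟩ := h2
      have hc := Finset.card_erase_of_mem hm
      have hpos := Finset.card_pos.2 ⟨m, hm⟩
      have hsub := Finset.erase_subset m B
      have := ih R (B.erase m) (by omega) hR (hB.mono (Finset.coe_subset.2 hsub)) hn
        fun m hm α β => hk m (hsub hm) α β
      have := meetCount_le_erase_right R B m
      rw [mul_add_one]
      omega
    push Not at h1 h2
    exact (not_forall_many_meets hR hB hn hE hk (by omega) hne h1 h2).elim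

theorem exists_forall_eval_ne_zero [Infinite K] {σ ι : Type*} (T : Finset ι)
    (p : ι → MvPolynomial σ K) (h : ∀ i ∈ T, p i ≠ 0) : ∃ z : σ → K, ∀ i ∈ T, eval z (p i) ≠ 0 := by
  by_contra! hz
  refine Finset.prod_ne_zero_iff.2 h (MvPolynomial.funext fun z => ?_)
  obtain ⟨i, hi, h0⟩ := hz z
  rw [map_zero, map_prod]
  exact Finset.prod_eq_zero hi h0

/-- A projective change of coordinates. -/
def tilt (α β γ : K) (q : K × K × K) : K × K × K :=
  ((q.1 - α * q.2.1 - γ * q.2.2) / (1 - β * q.2.1), q.2.1 / (1 - β * q.2.1),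
    q.2.2 / (1 - β * q.2.1))

theorem meets_tilt_iff {α β γ : K} {q r : K × K × K} (hq : 1 - β * q.2.1 ≠ 0)
    (hr : 1 - γ * r.2.1 ≠ 0) : Meets (tilt α β γ q) (tilt α γ β r) ↔ Meets q r := by
  simp only [Meets, tilt]
  rw [div_mul_div_comm, div_mul_div_comm, div_add_div _ _ (mul_ne_zero hq hr) hq,
    div_add_div _ _ (mul_ne_zero hr hq) hr, div_eq_div_iff
    (mul_ne_zero (mul_ne_zero hq hr) hq) (mul_ne_zero (mul_ne_zero hr hq) hr), ← sub_eq_zero]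
  have h : q.2.1 * r.1 + q.2.2 = r.2.1 * q.1 + r.2.2 ↔
      (q.2.1 * r.1 + q.2.2 - (r.2.1 * q.1 + r.2.2))
        * ((1 - β * q.2.1) * (1 - γ * r.2.1)) ^ 2 = 0 := by
    rw [mul_eq_zero, or_iff_left (pow_ne_zero 2 (mul_ne_zero hq hr)), sub_eq_zero]
  rw [h]
  constructor <;> intro h' <;> linear_combination h'

theorem exists_tilt_injOn [Infinite K] (S : Finset (K × K × K)) : ∃ α β γ : K,
    (∀ q ∈ S, 1 - β * q.2.1 ≠ 0) ∧ (∀ q ∈ S, 1 - γ * q.2.1 ≠ 0) ∧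
    Set.InjOn (fun q => (tilt α β γ q).1) (S : Set (K × K × K)) ∧
    Set.InjOn (fun q => (tilt α γ β q).1) (S : Set (K × K × K)) := by
  let den (i : Fin 3) (q : K × K × K) : MvPolynomial (Fin 3) K := 1 - X i * C q.2.1
  let num (i : Fin 3) (q : K × K × K) : MvPolynomial (Fin 3) K :=
    C q.1 - X 0 * C q.2.1 - X i * C q.2.2
  let diff (i j : Fin 3) (q r : K × K × K) := num i q * den j r - num i r * den j q
  have hden (i q) : den i q ≠ 0 := fun h => by
    have := congrArg (eval 0) h
    simp [den] at this
  have hdiff (i j : Fin 3) (hi : i ≠ 0) (hj : j ≠ 0) (hij : i ≠ j) (q r) (hqr : q ≠ r) :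
      diff i j q r ≠ 0 := fun h => by
    have h0 := congrArg (eval 0) h
    have h1 := congrArg (eval (Pi.single 0 1)) h
    have h2 := congrArg (eval (Pi.single i 1)) h
    simp [diff, num, den, hi, hi.symm, hj, hij.symm] at h0 h1 h2
    apply hqr
    have e0 : q.1 = r.1 := by linear_combination h0
    exact Prod.ext e0 (Prod.ext (by linear_combination h0 - h1) (by linear_combination h0 - h2))
  obtain ⟨z, hz⟩ := exists_forall_eval_ne_zero (S ×ˢ S)
    (fun p => (if p.1 = p.2 then 1 else diff 2 1 p.1 p.2 * diff 1 2 p.1 p.2) *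
      (den 1 p.1 * den 2 p.1))
    (fun p _ => by
      refine mul_ne_zero ?_ (mul_ne_zero (hden 1 _) (hden 2 _))
      split_ifs with h
      · exact one_ne_zero
      · exact mul_ne_zero (hdiff _ _ (by decide) (by decide) (by decide) _ _ h)
          (hdiff _ _ (by decide) (by decide) (by decide) _ _ h))
  have hz1 (q) (hq : q ∈ S) : 1 - z 1 * q.2.1 ≠ 0 ∧ 1 - z 2 * q.2.1 ≠ 0 := by
    have := hz (q, q) (Finset.mk_mem_product hq hq)
    rw [map_mul, map_mul] at this
    have := mul_ne_zero_iff.1 (right_ne_zero_of_mul this)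
    simpa [den] using this
  refine ⟨z 0, z 1, z 2, fun q hq => (hz1 q hq).1, fun q hq => (hz1 q hq).2, ?_, ?_⟩
  · intro q hq r hr h
    by_contra hqr
    have h1 := hz (q, r) (Finset.mk_mem_product hq hr)
    rw [if_neg hqr, map_mul, map_mul] at h1
    apply left_ne_zero_of_mul (left_ne_zero_of_mul h1)
    simp only [tilt, div_eq_div_iff (hz1 q hq).1 (hz1 r hr).1] at h
    simp [diff, num, den]
    linear_combination h
  · intro q hq r hr h
    by_contra hqr
    have h1 := hz (q, r) (Finset.mk_mem_product hq hr)
    rw [if_neg hqr, map_mul, map_mul] at h1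
    apply right_ne_zero_of_mul (left_ne_zero_of_mul h1)
    simp only [tilt, div_eq_div_iff (hz1 q hq).2 (hz1 r hr).2] at h
    simp [diff, num, den]
    linear_combination h

/-- The tilted points `(x, s, t)` of `S` that meet a given line and satisfy `s = M x + g` come from
collinear points of `S`, so two coordinate projections bound their number. -/
theorem card_meets_tilt_le {S : Finset (K × K × K)} {k : ℕ}
    (h1 : (S.image Prod.fst).card ≤ k) (h2 : (S.image fun q => q.2.2).card ≤ k)
    {α β γ : K} (hβ : ∀ q ∈ S, 1 - β * q.2.1 ≠ 0) {r : K × K × K}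
    (hγ : 1 - γ * r.2.1 ≠ 0) (hr : r.1 ≠ 0) (M g : K) :
    (S.filter fun q => Meets (tilt α β γ q) (tilt α γ β r) ∧
      (tilt α β γ q).2.1 = M * (tilt α β γ q).1 + g).card ≤ k := by
  set U := S.filter fun q => Meets (tilt α β γ q) (tilt α γ β r) ∧
      (tilt α β γ q).2.1 = M * (tilt α β γ q).1 + g with hU
  have hUS : U ⊆ S := Finset.filter_subset _ _
  have hmem (q) (hq : q ∈ U) : q.2.1 * r.1 + q.2.2 = r.2.1 * q.1 + r.2.2 ∧
      q.2.1 * (1 + M * α + g * β - M * γ * r.1)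
        = q.1 * (M * (1 - γ * r.2.1)) + (g - M * γ * r.2.2) := by
    obtain ⟨hqS, hm, he⟩ := Finset.mem_filter.1 hq
    rw [meets_tilt_iff (hβ q hqS) hγ] at hm
    refine ⟨hm, ?_⟩
    have he' : q.2.1 = M * (q.1 - α * q.2.1 - γ * q.2.2) + g * (1 - β * q.2.1) := by
      have h0 := hβ q hqS
      simp only [tilt] at he
      rw [← mul_div_assoc, div_add' _ _ _ h0, div_left_inj' h0] at he
      linear_combination he
    unfold Meets at hm
    linear_combination he' - M * γ * hm
  by_cases hc : 1 + M * α + g * β - M * γ * r.1 = 0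
  · have hM : M ≠ 0 ∨ U = ∅ := by
      by_contra! h
      obtain ⟨hM, q, hq⟩ := h
      have := (hmem q hq).2
      rw [hM] at this hc
      have hg : g = 0 := by linear_combination q.2.1 * hc - this
      rw [hg] at hc
      simp at hc
    rcases hM with hM | hM
    · refine le_trans ?_ h2
      refine Finset.card_le_card_of_injOn (fun q => q.2.2)
        (fun q hq => Finset.mem_image_of_mem _ (hUS hq)) ?_
      intro q hq q' hq' h
      obtain ⟨a1, a2⟩ := hmem q hq
      obtain ⟨b1, b2⟩ := hmem q' hq'
      rw [hc] at a2 b2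
      have e1 : q.1 = q'.1 :=
        mul_right_cancel₀ (mul_ne_zero hM hγ) (by linear_combination b2 - a2)
      refine Prod.ext e1 (Prod.ext (mul_right_cancel₀ hr ?_) h)
      dsimp only at h
      linear_combination a1 - b1 + r.2.1 * e1 - h
    · simp [hM]
  · refine le_trans ?_ h1
    refine Finset.card_le_card_of_injOn Prod.fst
      (fun q hq => Finset.mem_image_of_mem _ (hUS hq)) ?_
    intro q hq q' hq' h
    obtain ⟨a1, a2⟩ := hmem q hq
    obtain ⟨b1, b2⟩ := hmem q' hq'
    have e2 : q.2.1 = q'.2.1 := mul_right_cancel₀ hc (by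
      linear_combination a2 - b2 + (M * (1 - γ * r.2.1)) * h)
    exact Prod.ext h (Prod.ext e2 (by linear_combination a1 - b1 + r.2.1 * h - r.1 * e2))

theorem meetCount_self_le [Infinite K] {S : Finset (K × K × K)} {n k : ℕ}
    (hE : ∀ m : ℕ, 0 < m → m ≤ 6 * n + 1 → (m : K) ≠ 0) (hn : 3 * S.card < n ^ 2)
    (h1 : (S.image Prod.fst).card ≤ k) (h2 : (S.image fun q => q.2.2).card ≤ k)
    (h0 : ∀ q ∈ S, q.1 ≠ 0) : meetCount S S ≤ (12 * n + k + 1) * (2 * S.card) := by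
  obtain ⟨α, β, γ, hβ, hγ, hi, hj⟩ := exists_tilt_injOn S
  have hi' : Set.InjOn (tilt α β γ) (S : Set (K × K × K)) :=
    fun q hq r hr h => hi hq hr (congrArg Prod.fst h)
  have hj' : Set.InjOn (tilt α γ β) (S : Set (K × K × K)) :=
    fun q hq r hr h => hj hq hr (congrArg Prod.fst h)
  have hcR := Finset.card_image_of_injOn hi'
  have hcB := Finset.card_image_of_injOn hj'
  have key := meetCount_le_of_injOn (k := k) hE (2 * S.card)
    (S.image (tilt α β γ)) (S.image (tilt α γ β)) (by omega)
    (by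
      rw [Finset.coe_image]
      rintro _ ⟨q, hq, rfl⟩ _ ⟨r, hr, rfl⟩ h
      rw [hi hq hr h])
    (by
      rw [Finset.coe_image]
      rintro _ ⟨q, hq, rfl⟩ _ ⟨r, hr, rfl⟩ h
      rw [hj hq hr h])
    (by omega)
    (by
      intro m hm M g
      obtain ⟨r, hr, rfl⟩ := Finset.mem_image.1 hm
      rw [Finset.filter_image]
      exact Finset.card_image_le.trans (card_meets_tilt_le h1 h2 hβ (hγ r hr) (h0 r hr) M g))
  refine le_trans ?_ key
  refine Finset.card_le_card_of_injOn (fun p => (tilt α β γ p.1, tilt α γ β p.2)) ?_ ?_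
  · intro p hp
    rw [Finset.mem_coe, Finset.mem_filter, Finset.mem_product] at hp ⊢
    exact ⟨⟨Finset.mem_image_of_mem _ hp.1.1, Finset.mem_image_of_mem _ hp.1.2⟩,
      (meets_tilt_iff (hβ _ hp.1.1) (hγ _ hp.1.2)).2 hp.2⟩
  · intro p hp p' hp' h
    rw [Finset.mem_coe, Finset.mem_filter, Finset.mem_product] at hp hp'
    rw [Prod.mk.injEq] at h
    exact Prod.ext (hi' hp.1.1 hp'.1.1 h.1) (hj' hp.1.2 hp'.1.2 h.2)

theorem card_sq_le_card_mul_collisions {X Y : Type*} (T : Finset X) (P : Finset Y) (φ : X → Y)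
    (h : ∀ x ∈ T, φ x ∈ P) :
    T.card ^ 2 ≤ P.card * ((T ×ˢ T).filter fun p => φ p.1 = φ p.2).card := by
  have h1 := Finset.card_eq_sum_card_fiberwise (f := φ) (s := T) (t := P) h
  have h2 := Finset.card_eq_sum_card_fiberwise (f := fun p : X × X => φ p.1)
    (s := (T ×ˢ T).filter fun p => φ p.1 = φ p.2) (t := P)
    (fun p hp => h _ (Finset.mem_product.1 (Finset.mem_filter.1 hp).1).1)
  rw [h2, h1]
  refine sq_sum_le_card_mul_sum_sq.trans_eq ?_
  congr 1
  refine Finset.sum_congr rfl fun w _ => ?_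
  rw [sq, ← Finset.card_product]
  congr 1
  ext ⟨a, b⟩
  simp only [Finset.mem_product, Finset.mem_filter]
  grind

/-- The points `(x, a / (b + 1), a)` with `x ∈ A (A + 1)` and `a, b ∈ A`, which encode the lines
`y ↦ a (y / (b + 1) + 1)` together with an abscissa. -/
noncomputable def productPoints (A : Finset K) : Finset (K × K × K) :=
  ((A * (A + 1)) ×ˢ A ×ˢ A).image fun p => (p.1, p.2.1 / (p.2.2 + 1), p.2.1)

theorem card_productPoints {A : Finset K} (h0 : 0 ∉ A) :
    (productPoints A).card = (A * (A + 1)).card * A.card ^ 2 := by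
  rw [productPoints, Finset.card_image_of_injOn, Finset.card_product, Finset.card_product, sq]
  rintro ⟨x, a, b⟩ h ⟨x', a', b'⟩ - he
  simp only [Finset.coe_product, Set.mem_prod, Finset.mem_coe, Prod.mk.injEq] at h he ⊢
  obtain ⟨rfl, h1, rfl⟩ := he
  have ha : a ≠ 0 := fun h' => h0 (h' ▸ h.2.1)
  rw [div_eq_mul_inv, div_eq_mul_inv] at h1
  exact ⟨rfl, rfl, add_right_cancel (inv_injective (mul_left_cancel₀ ha h1))⟩

theorem card_pow_six_le_meetCount {A : Finset K} (h0 : 0 ∉ A) (h1 : -1 ∉ A) :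
    A.card ^ 6 ≤ (A * (A + 1)).card * meetCount (productPoints A) (productPoints A) := by
  have hA (a) (ha : a ∈ A) : a ≠ 0 ∧ a + 1 ≠ 0 :=
    ⟨fun h => h0 (h ▸ ha), fun h => h1 (eq_neg_of_add_eq_zero_left h ▸ ha)⟩
  have hP (a) (ha : a ∈ A) (b) (hb : b ∈ A) : a * (b + 1) ∈ A * (A + 1) :=
    Finset.mul_mem_mul ha (Finset.add_mem_add hb (Finset.mem_one.2 rfl))
  have h := card_sq_le_card_mul_collisions (A ×ˢ A ×ˢ A) (A * (A + 1))
    (fun p => p.1 * (p.2.2 + 1)) (fun p hp => by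
      simp only [Finset.mem_product] at hp
      exact hP _ hp.1 _ hp.2.2)
  rw [Finset.card_product, Finset.card_product] at h
  calc A.card ^ 6 = (A.card * (A.card * A.card)) ^ 2 := by ring
    _ ≤ _ := h
    _ ≤ _ := Nat.mul_le_mul_left _ ?_
  refine Finset.card_le_card_of_injOn
    (fun p => ((p.2.2.2 * (p.2.2.1 + 1), p.1.1 / (p.1.2.1 + 1), p.1.1),
      (p.1.2.2 * (p.1.2.1 + 1), p.2.1 / (p.2.2.1 + 1), p.2.1))) ?_ ?_
  · rintro ⟨⟨a, b, c⟩, ⟨a', b', c'⟩⟩ hp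
    simp only [Finset.coe_filter, Finset.mem_product, Set.mem_ofPred_eq] at hp
    obtain ⟨⟨⟨ha, hb, hc⟩, ha', hb', hc'⟩, he⟩ := hp
    rw [Finset.mem_coe, Finset.mem_filter, Finset.mem_product]
    refine ⟨⟨Finset.mem_image.2 ⟨(c' * (b' + 1), a, b), ?_, rfl⟩,
      Finset.mem_image.2 ⟨(c * (b + 1), a', b'), ?_, rfl⟩⟩, ?_⟩
    · exact Finset.mk_mem_product (hP _ hc' _ hb') (Finset.mk_mem_product ha hb)
    · exact Finset.mk_mem_product (hP _ hc _ hb) (Finset.mk_mem_product ha' hb')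
    · have hb1 := (hA b hb).2
      have hb1' := (hA b' hb').2
      simp only [Meets]
      field_simp
      linear_combination he
  · rintro ⟨⟨a, b, c⟩, ⟨a', b', c'⟩⟩ hp ⟨⟨a₁, b₁, c₁⟩, ⟨a₁', b₁', c₁'⟩⟩ - he
    simp only [Finset.coe_filter, Finset.mem_product, Set.mem_ofPred_eq] at hp
    obtain ⟨⟨⟨ha, hb, hc⟩, ha', hb', hc'⟩, -⟩ := hp
    simp only [Prod.mk.injEq] at he ⊢
    obtain ⟨⟨e1, e2, rfl⟩, e3, e4, rfl⟩ := he
    rw [div_eq_mul_inv, div_eq_mul_inv] at e2 e4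
    have f2 : b = b₁ := add_right_cancel (inv_injective (mul_left_cancel₀ (hA a ha).1 e2))
    have f4 : b' = b₁' := add_right_cancel (inv_injective (mul_left_cancel₀ (hA a' ha').1 e4))
    subst f2 f4
    exact ⟨⟨rfl, rfl, mul_right_cancel₀ (hA b hb).2 e3⟩, rfl, rfl,
      mul_right_cancel₀ (hA b' hb').2 e1⟩

theorem card_le_card_mul_add_one {A : Finset K} (h1 : -1 ∉ A) :
    A.card ≤ (A * (A + 1)).card := by
  rcases A.eq_empty_or_nonempty with rfl | ⟨b, hb⟩
  · simp
  have hb1 : b + 1 ≠ 0 := fun h => h1 (eq_neg_of_add_eq_zero_left h ▸ hb)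
  exact Finset.card_le_card_of_injOn (fun a => a * (b + 1))
    (fun a ha => Finset.mul_mem_mul ha (Finset.add_mem_add hb (Finset.mem_one.2 rfl)))
    (fun a _ a' _ h => mul_right_cancel₀ hb1 h)

theorem zero_notMem_mul_add_one {A : Finset K} (h0 : 0 ∉ A) (h1 : -1 ∉ A) :
    0 ∉ A * (A + 1) := by
  intro h
  obtain ⟨a, ha, c, hc, hac⟩ := Finset.mem_mul.1 h
  obtain ⟨b, hb, o, ho, rfl⟩ := Finset.mem_add.1 hc
  rw [Finset.mem_one] at ho
  subst ho
  rcases mul_eq_zero.1 hac with h | h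
  · exact h0 (h ▸ ha)
  · exact h1 (eq_neg_of_add_eq_zero_left h ▸ hb)

theorem card_pow_six_le_of_infinite [Infinite K] {A : Finset K} (h0 : 0 ∉ A) (h1 : -1 ∉ A)
    (hchar : ∀ p : ℕ, p.Prime → CharP K p → 507 * ((A * (A + 1)).card * A.card ^ 2) < p ^ 2) :
    A.card ^ 6 ≤ 8748 * (A * (A + 1)).card ^ 5 := by
  rcases A.eq_empty_or_nonempty with rfl | hne
  · simp
  by_cases hsmall : A.card ^ 6 < (A * (A + 1)).card ^ 5
  · omega
  have hI := card_pow_six_le_meetCount h0 h1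
  have hS := card_productPoints h0
  have hMP := card_le_card_mul_add_one h1
  have hM := Finset.card_pos.2 hne
  set M := A.card
  set P := (A * (A + 1)).card with hPdef
  set S := productPoints A with hSdef
  set N := P * M ^ 2 with hN
  have hPM : P ≤ M ^ 2 := by
    by_contra! hlt
    have h5 : (M ^ 2) ^ 5 < P ^ 5 := Nat.pow_lt_pow_left hlt (by norm_num)
    have h6 : M ^ 6 ≤ (M ^ 2) ^ 5 := by
      rw [← pow_mul]
      exact Nat.pow_le_pow_right hM (by norm_num)
    omega
  have hPN : P ^ 2 ≤ N := by
    rw [sq, hN]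
    exact Nat.mul_le_mul_left P hPM
  have hP0 : 0 < P := hM.trans_le hMP
  have hN0 : 0 < N := lt_of_lt_of_le (pow_pos hP0 2) hPN
  set v := Nat.sqrt (3 * N) with hv
  have hv1 : v ^ 2 ≤ 3 * N := Nat.sqrt_le' _
  have hv2 : 3 * N < (v + 1) ^ 2 := Nat.lt_succ_sqrt' _
  have hv0 : 1 ≤ v := by
    by_contra! h
    have : v = 0 := by omega
    rw [this] at hv2
    omega
  have hE : ∀ m : ℕ, 0 < m → m ≤ 6 * (v + 1) + 1 → (m : K) ≠ 0 := by
    intro m hm hm' hm0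
    obtain ⟨p, hp⟩ := CharP.exists K
    have hdvd := (CharP.cast_eq_zero_iff K p m).1 hm0
    have hpm := Nat.le_of_dvd hm hdvd
    rcases CharP.char_is_prime_or_zero K p with hpp | hpz
    · have := hchar p hpp hp
      have h13 : p ≤ 13 * v := by omega
      have := Nat.pow_le_pow_left h13 2
      rw [mul_pow] at this
      omega
    · rw [hpz, zero_dvd_iff] at hdvd
      omega
  have hcount := meetCount_self_le (S := S) (n := v + 1) (k := P) hE (by rw [hS]; exact hv2)
    (by
      refine Finset.card_le_card fun x hx => ?_
      obtain ⟨q, hq, rfl⟩ := Finset.mem_image.1 hx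
      obtain ⟨p, hp, rfl⟩ := Finset.mem_image.1 hq
      exact (Finset.mem_product.1 hp).1)
    (by
      refine (Finset.card_le_card fun x hx => ?_).trans hMP
      obtain ⟨q, hq, rfl⟩ := Finset.mem_image.1 hx
      obtain ⟨p, hp, rfl⟩ := Finset.mem_image.1 hq
      exact (Finset.mem_product.1 (Finset.mem_product.1 hp).2).1)
    (by
      intro q hq hq0
      obtain ⟨p, hp, rfl⟩ := Finset.mem_image.1 hq
      have := (Finset.mem_product.1 hp).1
      rw [show p.1 = 0 from hq0] at this
      exact zero_notMem_mul_add_one h0 h1 this)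
  rw [hS] at hcount
  have hPv : P ≤ 2 * v := by
    by_contra! hlt
    have : (2 * v) ^ 2 < P ^ 2 := Nat.pow_lt_pow_left hlt (by norm_num)
    nlinarith
  have hL : 12 * (v + 1) + P + 1 ≤ 27 * v := by omega
  have hfinal : M ^ 6 ≤ 54 * (P * (v * N)) := by
    calc M ^ 6 ≤ P * meetCount S S := hI
      _ ≤ P * (27 * v * (2 * N)) :=
        Nat.mul_le_mul_left _ (hcount.trans (Nat.mul_le_mul_right _ hL))
      _ = 54 * (P * (v * N)) := by ring
  have hsq : M ^ 6 * M ^ 6 ≤ 8748 * P ^ 5 * M ^ 6 := by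
    calc M ^ 6 * M ^ 6 ≤ (54 * (P * (v * N))) * (54 * (P * (v * N))) :=
          Nat.mul_le_mul hfinal hfinal
      _ = 2916 * (P ^ 2 * N ^ 2) * v ^ 2 := by ring
      _ ≤ 2916 * (P ^ 2 * N ^ 2) * (3 * N) := Nat.mul_le_mul_left _ hv1
      _ = 8748 * P ^ 5 * M ^ 6 := by rw [hN]; ring
  exact Nat.le_of_mul_le_mul_right hsq (pow_pos hM 6)

theorem card_pow_six_le {A : Finset K} (h0 : 0 ∉ A) (h1 : -1 ∉ A)
    (hchar : ∀ p : ℕ, p.Prime → CharP K p → 507 * ((A * (A + 1)).card * A.card ^ 2) < p ^ 2) :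
    A.card ^ 6 ≤ 8748 * (A * (A + 1)).card ^ 5 := by
  have hinj := (algebraMap K (AlgebraicClosure K)).injective
  have himg : (A * (A + 1)).image (algebraMap K (AlgebraicClosure K))
      = A.image (algebraMap K (AlgebraicClosure K))
        * (A.image (algebraMap K (AlgebraicClosure K)) + 1) := by
    rw [Finset.image_mul, Finset.image_add, Finset.image_one, map_one, Finset.singleton_one]
  have hc := Finset.card_image_of_injective A hinj
  have hc' := Finset.card_image_of_injective (A * (A + 1)) hinj
  have key := card_pow_six_le_of_infinite (A := A.image (algebraMap K (AlgebraicClosure K)))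
    (by
      intro h
      obtain ⟨a, ha, h⟩ := Finset.mem_image.1 h
      rw [map_eq_zero] at h
      exact h0 (h ▸ ha))
    (by
      intro h
      obtain ⟨a, ha, h⟩ := Finset.mem_image.1 h
      have : a = -1 := hinj (by rw [h, map_neg, map_one])
      exact h1 (this ▸ ha))
    (by
      intro p hp hpK
      rw [← himg, hc, hc']
      exact hchar p hp ((algebraMap K (AlgebraicClosure K)).charP hinj p))
  rwa [← himg, hc, hc'] at key

end PointPlane

theorem stmt_9 :
    ∃ c C : ℝ, 0 < c ∧ 0 < C ∧
      ∀ (F : Type) [Field F] (A : Finset F), A.Nonempty →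
        (∀ p : ℕ, p.Prime → CharP F p → (A.card : ℝ) ≤ c * (p : ℝ) ^ ((5 : ℝ) / 8)) →
        C * (A.card : ℝ) ^ ((6 : ℝ) / 5) ≤ ((A * (A + 1)).card : ℝ) := by
  refine ⟨1 / 40, 1 / 16, by norm_num, by norm_num, ?_⟩
  intro F _ A hA hchar
  have hA0 : (0 : ℝ) ≤ A.card := Nat.cast_nonneg _
  have hpow : ((1 / 16 : ℝ) * (A.card : ℝ) ^ ((6 : ℝ) / 5)) ^ 5 = (A.card : ℝ) ^ 6 / 1048576 := by
    rw [mul_pow, ← Real.rpow_natCast ((A.card : ℝ) ^ ((6 : ℝ) / 5)), ← Real.rpow_mul hA0]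
    norm_num
    rw [← Real.rpow_natCast]
    norm_num
    ring
  refine le_of_pow_le_pow_left₀ (n := 5) (by norm_num) (Nat.cast_nonneg _) ?_
  rw [hpow, div_le_iff₀ (by norm_num)]
  norm_cast
  have hPpos : 0 < (A * (A + 1)).card :=
    Finset.card_pos.2 (hA.mul (hA.add Finset.one_nonempty))
  by_cases h3 : A.card ≤ 3
  · have := Nat.pow_le_pow_left h3 6
    have := Nat.one_le_pow 5 _ hPpos
    omega
  by_contra! hlt
  let B := (A.erase 0).erase (-1)
  have hBA : B ⊆ A := (Finset.erase_subset _ _).trans (Finset.erase_subset _ _)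
  have hB0 : 0 ∉ B := by simp [B]
  have hB1 : -1 ∉ B := by simp [B]
  have hBcard : A.card ≤ 2 * B.card := by
    have := Finset.pred_card_le_card_erase (s := A) (a := 0)
    have := Finset.pred_card_le_card_erase (s := A.erase 0) (a := -1)
    change _ ≤ B.card at this
    omega
  have hPB : (B * (B + 1)).card ≤ (A * (A + 1)).card :=
    Finset.card_le_card (Finset.mul_subset_mul hBA (Finset.add_subset_add_right hBA))
  have hPB5 := Nat.pow_le_pow_left hPB 5
  have hB6 : A.card ^ 6 ≤ 64 * B.card ^ 6 := by
    have := Nat.pow_le_pow_left hBcard 6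
    rw [mul_pow] at this
    omega
  have key := PointPlane.card_pow_six_le hB0 hB1 (by
    intro p hp hpF
    have hp8 : 40 ^ 8 * A.card ^ 8 ≤ p ^ 5 := by
      have h := pow_le_pow_left₀ hA0 (hchar p hp hpF) 8
      rw [mul_pow, ← Real.rpow_natCast ((p : ℝ) ^ ((5 : ℝ) / 8)),
        ← Real.rpow_mul (Nat.cast_nonneg p)] at h
      have h85 : ((5 : ℝ) / 8 * ((8 : ℕ) : ℝ)) = ((5 : ℕ) : ℝ) := by norm_num
      rw [h85, Real.rpow_natCast] at h
      have : (40 : ℝ) ^ 8 * (A.card : ℝ) ^ 8 ≤ (p : ℝ) ^ 5 := by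
        rw [div_pow, one_pow, div_mul_eq_mul_div, one_mul, le_div_iff₀ (by norm_num)] at h
        linarith
      exact_mod_cast this
    have hcard : (B * (B + 1)).card ^ 5 ≤ A.card ^ 6 := by omega
    have hBle : B.card ^ 10 ≤ A.card ^ 10 := Nat.pow_le_pow_left (Finset.card_le_card hBA) 10
    refine lt_of_pow_lt_pow_left₀ 5 (Nat.zero_le _) ?_
    have hApos : 0 < A.card ^ 16 := pow_pos (Finset.card_pos.2 hA) 16
    calc (507 * ((B * (B + 1)).card * B.card ^ 2)) ^ 5
        = 507 ^ 5 * ((B * (B + 1)).card ^ 5 * B.card ^ 10) := by ring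
      _ ≤ 507 ^ 5 * (A.card ^ 6 * A.card ^ 10) :=
        Nat.mul_le_mul_left _ (Nat.mul_le_mul hcard hBle)
      _ = 507 ^ 5 * A.card ^ 16 := by ring
      _ < 40 ^ 16 * A.card ^ 16 := Nat.mul_lt_mul_of_pos_right (by norm_num) hApos
      _ = (40 ^ 8 * A.card ^ 8) ^ 2 := by ring
      _ ≤ (p ^ 5) ^ 2 := Nat.pow_le_pow_left hp8 2
      _ = (p ^ 2) ^ 5 := by ring)
  omega
end

section
/- There exist absolute constants c > 0 and C > 0 such that the following holds. Let F be a field and let A, B, C' ⊆ F be finite nonempty sets, none of which equals {0}. If F has positive characteristic p, assume |A|·|B|·|C'| ≤ c · p^2. Then |A + B·C'| ≥ C · (|A|·|B|·|C'|)^{1/2}, where A + B·C' = { a + b·c'' : a ∈ A, b ∈ B, c'' ∈ C' }. -/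
open scoped Classical Pointwise

/-- A line `{(t, x t + y, x² t + z)}` in three-space, with direction `(1, x, x²)` on a conic. -/
@[ext]
structure NullLine (R : Type*) where
  /-- The slope, which determines the direction. -/
  x : R
  /-- The second coordinate at time zero. -/
  y : R
  /-- The third coordinate at time zero. -/
  z : R

namespace NullLine

open MvPolynomial

section CommRing

variable {R : Type*} [CommRing R]

/-- The point of a null line at time `t`. -/
def point (l : NullLine R) (t : R) : Fin 3 → R :=
  ![t, l.x * t + l.y, l.x ^ 2 * t + l.z]

/-- Restriction of a polynomial function to a null line. -/
noncomputable def restrict (l : NullLine R) : MvPolynomial (Fin 3) R →ₐ[R] Polynomial R :=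
  aeval ![Polynomial.X, Polynomial.C l.x * Polynomial.X + Polynomial.C l.y,
    Polynomial.C (l.x ^ 2) * Polynomial.X + Polynomial.C l.z]

theorem eval_restrict (l : NullLine R) (t : R) (P : MvPolynomial (Fin 3) R) :
    (l.restrict P).eval t = eval (l.point t) P := by
  induction P using MvPolynomial.induction_on with
  | C a => simp [restrict]
  | add p q hp hq => simp [hp, hq]
  | mul_X p i hp =>
    rw [map_mul, Polynomial.eval_mul, hp, map_mul]
    congr 1
    fin_cases i <;> simp [restrict, point]

theorem natDegree_restrict_le (l : NullLine R) (P : MvPolynomial (Fin 3) R) :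
    (l.restrict P).natDegree ≤ P.totalDegree := by
  have h : ∀ i, ((![Polynomial.X, Polynomial.C l.x * Polynomial.X + Polynomial.C l.y,
      Polynomial.C (l.x ^ 2) * Polynomial.X + Polynomial.C l.z] : Fin 3 → Polynomial R) i).natDegree
        ≤ 1 := by
    intro i
    fin_cases i
    exacts [Polynomial.natDegree_X_le, Polynomial.natDegree_linear_le,
      Polynomial.natDegree_linear_le]
  simpa only [restrict, mul_one] using MvPolynomial.aeval_natDegree_le P le_rfl _ h

end CommRing

end NullLine

namespace MvPolynomial

variable (F : Type*) [Field F]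

theorem finrank_restrictTotalDegree_three (D : ℕ) :
    Module.finrank F (restrictTotalDegree (Fin 3) F D) = (D + 3).choose 3 := by
  have hset : {n : Fin 3 →₀ ℕ | (n.sum fun _ e => e) ≤ D} =
      (((Finset.range (D + 1)).biUnion fun k =>
        (Finset.univ : Finset (Fin 3)).finsuppAntidiag k : Finset (Fin 3 →₀ ℕ)) :
          Set (Fin 3 →₀ ℕ)) := by
    ext n
    simp [Finset.mem_finsuppAntidiag, Finsupp.sum_fintype]
  have hb := Module.finrank_eq_nat_card_basis
    (basisRestrictSupport F {n : Fin 3 →₀ ℕ | (n.sum fun _ e => e) ≤ D})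
  unfold restrictTotalDegree
  rw [hb, hset, Nat.card_coe_set_eq, Set.ncard_coe_finset, Finset.card_biUnion]
  · have h1 : ∀ k ∈ Finset.range (D + 1),
        ((Finset.univ : Finset (Fin 3)).finsuppAntidiag k).card = (k + 2).choose 2 := by
      intro k _
      rw [Finset.card_finsuppAntidiag_nat_eq_choose]
      simp only [Finset.card_univ, Fintype.card_fin]
      rw [show 3 + k - 1 = k + 2 by omega]
      exact Nat.choose_symm_of_eq_add (by omega)
    rw [Finset.sum_congr rfl h1, Nat.sum_range_add_choose]
  · intro i _ j _ hij
    rw [Function.onFun, Finset.disjoint_left]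
    intro n hi hj
    simp only [Finset.mem_finsuppAntidiag] at hi hj
    exact hij (hi.1.symm.trans hj.1)

end MvPolynomial

theorem choose_three_second_difference (m e f : ℕ) :
    (m + e + f + 3).choose 3 + (m + 3).choose 3 ≤
      (m + f + 3).choose 3 + (m + e + 3).choose 3 + e * f * (m + e + f + 1) := by
  have key : ∀ n : ℕ, 6 * (n + 3).choose 3 = (n + 1) * (n + 2) * (n + 3) := by
    intro n
    have := Nat.descFactorial_eq_factorial_mul_choose (n + 3) 3
    rw [show (3 : ℕ).factorial = 6 by rfl] at this
    rw [← this]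
    simp [Nat.descFactorial]
    ring
  have h1 := key (m + e + f)
  have h2 := key m
  have h3 := key (m + f)
  have h4 := key (m + e)
  have h5 : e * f ≤ e * f * e := by
    rcases Nat.eq_zero_or_pos e with h | h
    · simp [h]
    · exact Nat.le_mul_of_pos_right _ h
  have h6 : e * f ≤ e * f * f := by
    rcases Nat.eq_zero_or_pos f with h | h
    · simp [h]
    · exact Nat.le_mul_of_pos_right _ h
  nlinarith

namespace NullLine

open MvPolynomial

variable {F : Type*} [Field F]

theorem exists_vanishing {X : Finset (NullLine F)} {d : ℕ}
    (h : X.card * (d + 1) < (d + 3).choose 3) :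
    ∃ P : MvPolynomial (Fin 3) F, P ≠ 0 ∧ P.totalDegree ≤ d ∧ ∀ l ∈ X, l.restrict P = 0 := by
  let ρ : restrictTotalDegree (Fin 3) F d →ₗ[F] (X → Polynomial.degreeLT F (d + 1)) :=
    LinearMap.pi fun l => LinearMap.codRestrict _
      (l.1.restrict.toLinearMap ∘ₗ (restrictTotalDegree (Fin 3) F d).subtype) (by
        intro P
        rw [Polynomial.mem_degreeLT]
        refine lt_of_le_of_lt Polynomial.degree_le_natDegree ?_
        have h1 := l.1.natDegree_restrict_le P.1
        have h2 := (mem_restrictTotalDegree _ _ _).1 P.2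
        simp only [LinearMap.comp_apply, AlgHom.toLinearMap_apply, Submodule.subtype_apply]
        exact_mod_cast Nat.lt_succ_of_le (h1.trans h2))
  have hker : LinearMap.ker ρ ≠ ⊥ := by
    apply LinearMap.ker_ne_bot_of_finrank_lt
    rw [finrank_restrictTotalDegree_three, Module.finrank_pi_fintype]
    simpa [(Polynomial.degreeLTEquiv F (d + 1)).finrank_eq] using h
  obtain ⟨P, hP, hP0⟩ := Submodule.exists_mem_ne_zero_of_ne_bot hker
  refine ⟨P.1, fun h0 => hP0 (Subtype.ext h0), (mem_restrictTotalDegree _ _ _).1 P.2, ?_⟩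
  intro l hl
  have := congrFun (LinearMap.mem_ker.1 hP) ⟨l, hl⟩
  exact congrArg Subtype.val this

/-- A polynomial of degree at most one vanishing on one null line but not on another. -/
theorem exists_separating {l l' : NullLine F} (h : l ≠ l') :
    ∃ g : MvPolynomial (Fin 3) F, g.totalDegree ≤ 1 ∧ l'.restrict g = 0 ∧ l.restrict g ≠ 0 := by
  have hlin : ∀ (i : Fin 3) (a b : F),
      (X i - (C a * X 0 + C b) : MvPolynomial (Fin 3) F).totalDegree ≤ 1 := by
    intro i a b
    refine (totalDegree_sub _ _).trans (max_le (by simp) ?_)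
    refine (totalDegree_add _ _).trans (max_le ?_ (by simp))
    refine (totalDegree_mul _ _).trans (by simp)
  by_cases hxy : l.x = l'.x ∧ l.y = l'.y
  · refine ⟨X 2 - (C (l'.x ^ 2) * X 0 + C l'.z), hlin _ _ _, by simp [restrict], ?_⟩
    intro h0
    have h1 := congrArg (Polynomial.eval 0) h0
    simp [restrict, sub_eq_zero] at h1
    exact h (NullLine.ext hxy.1 hxy.2 h1)
  · refine ⟨X 1 - (C l'.x * X 0 + C l'.y), hlin _ _ _, by simp [restrict], ?_⟩
    intro h0
    have h1 := congrArg (Polynomial.eval 0) h0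
    have h2 := congrArg (Polynomial.eval 1) h0
    simp [restrict, sub_eq_zero] at h1 h2
    rw [h1] at h2
    exact hxy ⟨add_right_cancel h2, h1⟩

theorem exists_separating_finset (X : Finset (NullLine F)) (l : NullLine F) :
    ∃ g : MvPolynomial (Fin 3) F, g.totalDegree ≤ (X.erase l).card ∧
      (∀ l' ∈ X.erase l, l'.restrict g = 0) ∧ l.restrict g ≠ 0 := by
  have hsep : ∀ l' : NullLine F, ∃ g : MvPolynomial (Fin 3) F, l ≠ l' →
      g.totalDegree ≤ 1 ∧ l'.restrict g = 0 ∧ l.restrict g ≠ 0 := by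
    intro l'
    by_cases h : l = l'
    · exact ⟨0, fun h' => absurd h h'⟩
    · obtain ⟨g, hg⟩ := exists_separating h
      exact ⟨g, fun _ => hg⟩
  choose g hg using hsep
  refine ⟨∏ l' ∈ X.erase l, g l', ?_, ?_, ?_⟩
  · refine (totalDegree_finsetProd _ _).trans ?_
    rw [Finset.card_eq_sum_ones]
    exact Finset.sum_le_sum fun l' hl' => (hg l' (Finset.ne_of_mem_erase hl').symm).1
  · intro l' hl'
    rw [map_prod]
    exact Finset.prod_eq_zero hl' (hg l' (Finset.ne_of_mem_erase hl').symm).2.1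
  · rw [map_prod]
    exact Finset.prod_ne_zero_iff.2 fun l' hl' =>
      (hg l' (Finset.ne_of_mem_erase hl').symm).2.2

theorem card_mul_le_finrank_range (X : Finset (NullLine F)) (D : ℕ) (hD : X.card ≤ D) :
    X.card * (D + 2 - X.card) ≤ Module.finrank F (LinearMap.range
      ((LinearMap.pi fun l : X => l.1.restrict.toLinearMap) ∘ₗ
        (restrictTotalDegree (Fin 3) F D).subtype)) := by
  set ρ := ((LinearMap.pi fun l : X => l.1.restrict.toLinearMap) ∘ₗ
        (restrictTotalDegree (Fin 3) F D).subtype) with hρ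
  choose g hg1 hg2 hg3 using exists_separating_finset X
  let q : X × Fin (D + 2 - X.card) → MvPolynomial (Fin 3) F :=
    fun i => g i.1 * MvPolynomial.X 0 ^ (i.2 : ℕ)
  have hq : ∀ i, q i ∈ restrictTotalDegree (Fin 3) F D := by
    intro i
    rw [mem_restrictTotalDegree]
    refine (totalDegree_mul _ _).trans ?_
    have h1 := hg1 i.1
    rw [Finset.card_erase_of_mem i.1.2] at h1
    have h2 : (MvPolynomial.X (R := F) (0 : Fin 3) ^ (i.2 : ℕ)).totalDegree = (i.2 : ℕ) := by
      simp
    have h3 := i.2.2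
    have h4 : 0 < X.card := Finset.card_pos.2 ⟨_, i.1.2⟩
    omega
  have hli : LinearIndependent F fun i => ρ ⟨q i, hq i⟩ := by
    rw [Fintype.linearIndependent_iff]
    intro c hc i
    have h1 := congrFun hc i.1
    have h2 : (∑ j : Fin (D + 2 - X.card), c (i.1, j) • (Polynomial.X ^ (j : ℕ) : Polynomial F)) *
        i.1.1.restrict (g i.1) = 0 := by
      rw [Finset.sum_apply, Fintype.sum_prod_type] at h1
      rw [Finset.sum_eq_single i.1] at h1
      · rw [Finset.sum_mul]
        refine Eq.trans ?_ h1
        refine Finset.sum_congr rfl fun j _ => ?_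
        have hX : i.1.1.restrict (MvPolynomial.X 0) = Polynomial.X := by simp [restrict]
        simp only [hρ, q, Pi.smul_apply, LinearMap.comp_apply, LinearMap.pi_apply,
          AlgHom.toLinearMap_apply, Submodule.subtype_apply, map_mul, map_pow, hX]
        rw [smul_mul_assoc, mul_comm]
      · intro l _ hl
        apply Finset.sum_eq_zero
        intro j _
        have := hg2 l.1 i.1.1 (Finset.mem_erase.2 ⟨fun h => hl (Subtype.ext h).symm, i.1.2⟩)
        simp [hρ, q, this]
      · simp
    rcases mul_eq_zero.1 h2 with h3 | h3
    · have h4 := congrArg (fun p => Polynomial.coeff p (i.2 : ℕ)) h3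
      simp only [Polynomial.finsetSum_coeff, Polynomial.coeff_smul, Polynomial.coeff_X_pow,
        Polynomial.coeff_zero] at h4
      rw [Finset.sum_eq_single i.2] at h4
      · simpa using h4
      · intro j _ hj
        have : (i.2 : ℕ) ≠ j := fun h => hj (Fin.ext h.symm)
        simp [this]
      · simp
    · exact absurd h3 (hg3 _)
  have h1 := finrank_span_eq_card hli
  have h2 : Submodule.span F (Set.range fun i => ρ ⟨q i, hq i⟩) ≤ LinearMap.range ρ := by
    rw [Submodule.span_le]
    rintro _ ⟨i, rfl⟩
    exact LinearMap.mem_range_self _ _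
  have h3 := Submodule.finrank_mono h2
  rw [h1] at h3
  simpa using h3

/-- A weak form of the Bézout theorem: two surfaces without a common component have few null lines
in common. -/
theorem card_le_of_prime {P Q : MvPolynomial (Fin 3) F} (hP : Prime P) (hPQ : ¬ P ∣ Q)
    {X : Finset (NullLine F)} (hXP : ∀ l ∈ X, l.restrict P = 0) (hXQ : ∀ l ∈ X, l.restrict Q = 0) :
    X.card ≤ P.totalDegree * Q.totalDegree := by
  by_contra! hlt
  set n := X.card with hn
  set e := P.totalDegree with he
  set f := Q.totalDegree with hf
  have hQ0 : Q ≠ 0 := fun h => hPQ (h ▸ dvd_zero _)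
  set m := n ^ 2 with hm
  set D := m + e + f with hD
  have hnm : n ≤ m := by rw [hm]; nlinarith
  let φ : (restrictTotalDegree (Fin 3) F (m + f) × restrictTotalDegree (Fin 3) F (m + e)) →ₗ[F]
      MvPolynomial (Fin 3) F :=
    (LinearMap.mulLeft F P ∘ₗ (restrictTotalDegree (Fin 3) F (m + f)).subtype).coprod
      (LinearMap.mulLeft F Q ∘ₗ (restrictTotalDegree (Fin 3) F (m + e)).subtype)
  have hφ : ∀ a, φ a = P * a.1.1 + Q * a.2.1 := fun a => by simp [φ]
  have hdimφ := LinearMap.finrank_range_add_finrank_ker φ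
  rw [Module.finrank_prod, finrank_restrictTotalDegree_three,
    finrank_restrictTotalDegree_three] at hdimφ
  have hker : Module.finrank F (LinearMap.ker φ) ≤ (m + 3).choose 3 := by
    rw [← finrank_restrictTotalDegree_three F]
    let ψ : restrictTotalDegree (Fin 3) F m →ₗ[F] MvPolynomial (Fin 3) F × MvPolynomial (Fin 3) F :=
      (LinearMap.mulLeft F (-Q) ∘ₗ (restrictTotalDegree (Fin 3) F m).subtype).prod
        (LinearMap.mulLeft F P ∘ₗ (restrictTotalDegree (Fin 3) F m).subtype)
    let ι : LinearMap.ker φ →ₗ[F] MvPolynomial (Fin 3) F × MvPolynomial (Fin 3) F :=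
      ((restrictTotalDegree (Fin 3) F (m + f)).subtype.prodMap
        (restrictTotalDegree (Fin 3) F (m + e)).subtype) ∘ₗ (LinearMap.ker φ).subtype
    have hι : Function.Injective ι := by
      rintro ⟨⟨a, b⟩, h⟩ ⟨⟨a', b'⟩, h'⟩ hab
      simp [ι] at hab
      simp [hab.1, hab.2]
    have hle : LinearMap.range ι ≤ LinearMap.range ψ := by
      rintro _ ⟨⟨⟨a, b⟩, h⟩, rfl⟩
      have h0 : P * a.1 + Q * b.1 = 0 := by rw [← hφ (a, b)]; exact h
      have hdvd : P ∣ b.1 := by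
        have : P ∣ Q * b.1 := ⟨-a.1, by linear_combination h0⟩
        exact (hP.dvd_or_dvd this).resolve_left hPQ
      obtain ⟨c, hc⟩ := hdvd
      have ha : a.1 = -Q * c := by
        apply mul_left_cancel₀ hP.ne_zero
        linear_combination h0 - Q * hc
      have hcdeg : c.totalDegree ≤ m := by
        by_cases hc0 : c = 0
        · simp [hc0]
        · have hb := (mem_restrictTotalDegree _ _ _).1 b.2
          rw [hc, totalDegree_mul_of_isDomain hP.ne_zero hc0] at hb
          omega
      refine ⟨⟨c, (mem_restrictTotalDegree _ _ _).2 hcdeg⟩, ?_⟩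
      simp [ψ, ι, ha, hc]
    rw [← LinearMap.finrank_range_of_inj hι]
    exact (Submodule.finrank_mono hle).trans (LinearMap.finrank_range_le ψ)
  set ρ := ((LinearMap.pi fun l : X => l.1.restrict.toLinearMap) ∘ₗ
        (restrictTotalDegree (Fin 3) F D).subtype) with hρ
  have hdimρ := LinearMap.finrank_range_add_finrank_ker ρ
  rw [finrank_restrictTotalDegree_three] at hdimρ
  have hφρ : Module.finrank F (LinearMap.range φ) ≤ Module.finrank F (LinearMap.ker ρ) := by
    have h1 : LinearMap.range φ ≤
        (LinearMap.ker ρ).map (restrictTotalDegree (Fin 3) F D).subtype := by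
      rintro _ ⟨⟨a, b⟩, rfl⟩
      rw [hφ]
      have ha := (mem_restrictTotalDegree _ _ _).1 a.2
      have hb := (mem_restrictTotalDegree _ _ _).1 b.2
      refine ⟨⟨P * a.1 + Q * b.1, ?_⟩, ?_, rfl⟩
      · rw [mem_restrictTotalDegree]
        refine (totalDegree_add _ _).trans (max_le ?_ ?_)
        · exact (totalDegree_mul _ _).trans (by omega)
        · exact (totalDegree_mul _ _).trans (by omega)
      · rw [SetLike.mem_coe, LinearMap.mem_ker]
        ext1 l
        simp [hρ, hXP l.1 l.2, hXQ l.1 l.2]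
    exact (Submodule.finrank_mono h1).trans (Submodule.finrank_map_le _ _)
  have hrange := card_mul_le_finrank_range X D (by omega)
  rw [← hρ, ← hn] at hrange
  have hbin := choose_three_second_difference m e f
  rw [← hD] at hbin
  have h1 : n * (D + 2 - n) ≤ e * f * (D + 1) := by omega
  have h2 : e * f * (D + 1) ≤ (n - 1) * (D + 1) := Nat.mul_le_mul_right _ (by omega)
  have h3 : n ≤ D + 2 := by omega
  have hn1 : 1 ≤ n := by omega
  zify [h3, hn1] at h1 h2
  have h4 : (D : ℤ) = n ^ 2 + e + f := by rw [hD, hm]; push_cast; ring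
  nlinarith

end NullLine

namespace MvPolynomial

theorem totalDegree_pderiv_le {σ R : Type*} [CommSemiring R] (i : σ) (P : MvPolynomial σ R) :
    (pderiv i P).totalDegree ≤ P.totalDegree - 1 := by
  refine Finset.sup_le fun s hs => ?_
  have h1 : s + Finsupp.single i 1 ∈ P.support := by
    rw [mem_support_iff] at hs ⊢
    intro h
    rw [coeff_pderiv, h, zero_mul] at hs
    exact hs rfl
  have h2 := le_totalDegree h1
  rw [Finsupp.sum_add_index' (fun _ => rfl) (fun _ _ _ => rfl),
    Finsupp.sum_single_index rfl] at h2
  omega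

section CommRing

variable {R : Type*} [CommRing R]

/-- Differentiation of polynomials in three variables along the direction `(1, x, x²)`. -/
noncomputable def dirDeriv (x : R) :
    Derivation R (MvPolynomial (Fin 3) R) (MvPolynomial (Fin 3) R) :=
  pderiv 0 + x • pderiv 1 + x ^ 2 • pderiv 2

theorem dirDeriv_apply (x : R) (P : MvPolynomial (Fin 3) R) :
    dirDeriv x P = C (x ^ 2) * pderiv 2 P + C x * pderiv 1 P + pderiv 0 P := by
  simp only [dirDeriv, Derivation.add_apply, Derivation.smul_apply, smul_eq_C_mul]
  ring

theorem dirDeriv_dirDeriv (x : R) (P : MvPolynomial (Fin 3) R) :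
    dirDeriv x (dirDeriv x P) =
      C x ^ 4 * pderiv 2 (pderiv 2 P)
      + C x ^ 3 * (pderiv 1 (pderiv 2 P) + pderiv 2 (pderiv 1 P))
      + C x ^ 2 * (pderiv 1 (pderiv 1 P) + pderiv 0 (pderiv 2 P) + pderiv 2 (pderiv 0 P))
      + C x * (pderiv 0 (pderiv 1 P) + pderiv 1 (pderiv 0 P)) + pderiv 0 (pderiv 0 P) := by
  simp only [dirDeriv_apply, map_add, pderiv_C_mul]
  simp only [map_pow]
  ring

/-- The leading coefficient of the remainder of the second derivative along `(1, x, x²)` modulo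
the first one, as polynomials in `x`. -/
noncomputable def contactLead (P : MvPolynomial (Fin 3) R) : MvPolynomial (Fin 3) R :=
  pderiv 2 P * (pderiv 2 P * (pderiv 2 P * (pderiv 0 (pderiv 1 P) + pderiv 1 (pderiv 0 P)))
    - (pderiv 2 P * (pderiv 1 (pderiv 2 P) + pderiv 2 (pderiv 1 P))
        - pderiv 2 (pderiv 2 P) * pderiv 1 P) * pderiv 0 P)
  - (pderiv 2 P * (pderiv 2 P * (pderiv 1 (pderiv 1 P) + pderiv 0 (pderiv 2 P)
        + pderiv 2 (pderiv 0 P)) - pderiv 2 (pderiv 2 P) * pderiv 0 P)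
    - (pderiv 2 P * (pderiv 1 (pderiv 2 P) + pderiv 2 (pderiv 1 P))
        - pderiv 2 (pderiv 2 P) * pderiv 1 P) * pderiv 1 P) * pderiv 1 P

/-- The constant coefficient of the remainder of the second derivative along `(1, x, x²)` modulo
the first one, as polynomials in `x`. -/
noncomputable def contactConst (P : MvPolynomial (Fin 3) R) : MvPolynomial (Fin 3) R :=
  pderiv 2 P * (pderiv 2 P * (pderiv 2 P * pderiv 0 (pderiv 0 P)))
  - (pderiv 2 P * (pderiv 2 P * (pderiv 1 (pderiv 1 P) + pderiv 0 (pderiv 2 P)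
        + pderiv 2 (pderiv 0 P)) - pderiv 2 (pderiv 2 P) * pderiv 0 P)
    - (pderiv 2 P * (pderiv 1 (pderiv 2 P) + pderiv 2 (pderiv 1 P))
        - pderiv 2 (pderiv 2 P) * pderiv 1 P) * pderiv 1 P) * pderiv 0 P

theorem exists_contact_division (x : R) (P : MvPolynomial (Fin 3) R) :
    ∃ S, pderiv 2 P ^ 3 * dirDeriv x (dirDeriv x P) =
      S * dirDeriv x P + contactLead P * C x + contactConst P := by
  refine ⟨pderiv 2 P ^ 2 * (pderiv 2 (pderiv 2 P) * C x ^ 2)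
    + pderiv 2 P * ((pderiv 2 P * (pderiv 1 (pderiv 2 P) + pderiv 2 (pderiv 1 P))
        - pderiv 2 (pderiv 2 P) * pderiv 1 P) * C x)
    + (pderiv 2 P * (pderiv 2 P * (pderiv 1 (pderiv 1 P) + pderiv 0 (pderiv 2 P)
        + pderiv 2 (pderiv 0 P)) - pderiv 2 (pderiv 2 P) * pderiv 0 P)
    - (pderiv 2 P * (pderiv 1 (pderiv 2 P) + pderiv 2 (pderiv 1 P))
        - pderiv 2 (pderiv 2 P) * pderiv 1 P) * pderiv 1 P), ?_⟩
  rw [dirDeriv_dirDeriv, dirDeriv_apply, contactLead, contactConst, C_pow]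
  ring

theorem map_contactLead {S : Type*} [CommRing S] (f : R →+* S) (P : MvPolynomial (Fin 3) R) :
    map f (contactLead P) = contactLead (map f P) := by
  simp only [contactLead, map_sub, map_mul, map_add, pderiv_map]

theorem map_contactConst {S : Type*} [CommRing S] (f : R →+* S) (P : MvPolynomial (Fin 3) R) :
    map f (contactConst P) = contactConst (map f P) := by
  simp only [contactConst, map_sub, map_mul, map_add, pderiv_map]

theorem totalDegree_add_le_of_le {σ : Type*} {p q : MvPolynomial σ R} {n : ℕ}
    (hp : p.totalDegree ≤ n) (hq : q.totalDegree ≤ n) : (p + q).totalDegree ≤ n :=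
  (totalDegree_add _ _).trans (max_le hp hq)

theorem totalDegree_sub_le_of_le {σ : Type*} {p q : MvPolynomial σ R} {n : ℕ}
    (hp : p.totalDegree ≤ n) (hq : q.totalDegree ≤ n) : (p - q).totalDegree ≤ n :=
  (totalDegree_sub _ _).trans (max_le hp hq)

theorem totalDegree_mul_le_of_le {σ : Type*} {p q : MvPolynomial σ R} {m n : ℕ}
    (hp : p.totalDegree ≤ m) (hq : q.totalDegree ≤ n) : (p * q).totalDegree ≤ m + n :=
  (totalDegree_mul _ _).trans (add_le_add hp hq)

theorem totalDegree_contact_le (P : MvPolynomial (Fin 3) R) :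
    (contactLead P).totalDegree ≤ 4 * P.totalDegree ∧
      (contactConst P).totalDegree ≤ 4 * P.totalDegree := by
  set e := P.totalDegree with he
  have h1 : ∀ i, (pderiv i P).totalDegree ≤ e := fun i =>
    (totalDegree_pderiv_le i P).trans (Nat.sub_le _ _)
  have h2 : ∀ i j, (pderiv i (pderiv j P)).totalDegree ≤ e := fun i j =>
    (totalDegree_pderiv_le i _).trans ((Nat.sub_le _ _).trans (h1 j))
  have h3 : (pderiv 2 P * (pderiv 1 (pderiv 2 P) + pderiv 2 (pderiv 1 P))
        - pderiv 2 (pderiv 2 P) * pderiv 1 P).totalDegree ≤ e + e :=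
    totalDegree_sub_le_of_le
      (totalDegree_mul_le_of_le (h1 _) (totalDegree_add_le_of_le (h2 _ _) (h2 _ _)))
      (totalDegree_mul_le_of_le (h2 _ _) (h1 _))
  have h4 : (pderiv 2 P * (pderiv 2 P * (pderiv 1 (pderiv 1 P) + pderiv 0 (pderiv 2 P)
        + pderiv 2 (pderiv 0 P)) - pderiv 2 (pderiv 2 P) * pderiv 0 P)
    - (pderiv 2 P * (pderiv 1 (pderiv 2 P) + pderiv 2 (pderiv 1 P))
        - pderiv 2 (pderiv 2 P) * pderiv 1 P) * pderiv 1 P).totalDegree ≤ e + (e + e) := by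
    refine totalDegree_sub_le_of_le (totalDegree_mul_le_of_le (h1 _)
      (totalDegree_sub_le_of_le (totalDegree_mul_le_of_le (h1 _) (totalDegree_add_le_of_le
        (totalDegree_add_le_of_le (h2 _ _) (h2 _ _)) (h2 _ _)))
        (totalDegree_mul_le_of_le (h2 _ _) (h1 _)))) ?_
    rw [add_comm e]
    exact totalDegree_mul_le_of_le h3 (h1 _)
  rw [show 4 * e = e + (e + (e + e)) by ring]
  constructor
  · refine totalDegree_sub_le_of_le (totalDegree_mul_le_of_le (h1 _)
      (totalDegree_sub_le_of_le (totalDegree_mul_le_of_le (h1 _) (totalDegree_mul_le_of_le (h1 _)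
        (totalDegree_add_le_of_le (h2 _ _) (h2 _ _)))) ?_)) ?_
    · rw [add_comm e]
      exact totalDegree_mul_le_of_le h3 (h1 _)
    · rw [add_comm e]
      exact totalDegree_mul_le_of_le h4 (h1 _)
  · refine totalDegree_sub_le_of_le (totalDegree_mul_le_of_le (h1 _)
      (totalDegree_mul_le_of_le (h1 _) (totalDegree_mul_le_of_le (h1 _) (h2 _ _)))) ?_
    rw [add_comm e]
    exact totalDegree_mul_le_of_le h4 (h1 _)

theorem exists_eval_add_third (P : MvPolynomial (Fin 3) R) (t y z h : R) :
    ∃ w, eval ![t, y, z + h] P =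
      eval ![t, y, z] P + h * (eval ![t, y, z] (pderiv 2 P) + h * w) := by
  induction P using MvPolynomial.induction_on with
  | C a => exact ⟨0, by simp⟩
  | add p q hp hq =>
    obtain ⟨w, hw⟩ := hp
    obtain ⟨w', hw'⟩ := hq
    exact ⟨w + w', by simp only [map_add, hw, hw']; ring⟩
  | mul_X p i hp =>
    obtain ⟨w, hw⟩ := hp
    fin_cases i
    · refine ⟨w * t, ?_⟩
      simp [hw, Derivation.leibniz, pderiv_X]
      ring
    · refine ⟨w * y, ?_⟩
      simp [hw, Derivation.leibniz, pderiv_X]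
      ring
    · refine ⟨w * (z + h) + eval ![t, y, z] (pderiv 2 p), ?_⟩
      simp [hw, Derivation.leibniz, pderiv_X]
      ring

end CommRing

end MvPolynomial

/-- If `π ^ N * D (D P)` lies in the ideal `(P, D P)`, then so does a multiple by a power of `π` of
every iterated derivative of `P`. -/
theorem Derivation.exists_pow_mul_iterate_mem {R A : Type*} [CommRing R] [CommRing A] [Algebra R A]
    (D : Derivation R A A) {P π : A} {N : ℕ} {I : Ideal A} (hI : I = Ideal.span {P, D P})
    (h : π ^ N * D (D P) ∈ I) (k : ℕ) : ∃ n, π ^ (n + 1) * D^[k] P ∈ I := by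
  have hstable : ∀ g ∈ I, π ^ N * D g ∈ I := by
    intro g hg
    have hP : P ∈ I := hI ▸ Ideal.subset_span (by simp)
    have hDP : D P ∈ I := hI ▸ Ideal.subset_span (by simp)
    rw [hI, Ideal.mem_span_pair] at hg
    obtain ⟨a, b, rfl⟩ := hg
    have : π ^ N * D (a * P + b * D P) =
        (π ^ N * D a) * P + (π ^ N * (a + D b)) * D P + b * (π ^ N * D (D P)) := by
      simp only [map_add, Derivation.leibniz, smul_eq_mul]
      ring
    rw [this]
    exact I.add_mem (I.add_mem (I.mul_mem_left _ hP) (I.mul_mem_left _ hDP)) (I.mul_mem_left _ h)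
  induction k with
  | zero => exact ⟨0, I.mul_mem_left _ (hI ▸ Ideal.subset_span (by simp))⟩
  | succ k ih =>
    obtain ⟨n, hn⟩ := ih
    refine ⟨N + n + 1, ?_⟩
    rw [Function.iterate_succ_apply']
    set f := D^[k] P
    have h1 : π ^ (N + n + 1 + 1) * D f = π * (π ^ N * D (π ^ (n + 1) * f)) -
        (n + 1) * π ^ N * D π * (π ^ (n + 1) * f) := by
      simp only [Derivation.leibniz, Derivation.leibniz_pow, smul_eq_mul, nsmul_eq_mul,
        Nat.add_sub_cancel]
      push_cast
      ring
    rw [h1]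
    exact I.sub_mem (I.mul_mem_left _ (hstable _ hn)) (I.mul_mem_left _ hn)

namespace NullLine

open MvPolynomial

section CommRing

variable {R : Type*} [CommRing R]

theorem derivative_restrict (l : NullLine R) (P : MvPolynomial (Fin 3) R) :
    Polynomial.derivative (l.restrict P) = l.restrict (dirDeriv l.x P) := by
  induction P using MvPolynomial.induction_on with
  | C a => simp [restrict]
  | add p q hp hq => simp [hp, hq]
  | mul_X p i hp =>
    rw [map_mul, Polynomial.derivative_mul, hp, Derivation.leibniz, map_add, smul_eq_mul,
      smul_eq_mul, map_mul, map_mul, dirDeriv_apply l.x (X i)]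
    fin_cases i <;> simp [restrict, pderiv_X, Polynomial.derivative_pow] <;> ring

theorem restrict_dirDeriv_eq_zero {l : NullLine R} {P : MvPolynomial (Fin 3) R}
    (h : l.restrict P = 0) : l.restrict (dirDeriv l.x P) = 0 := by
  rw [← derivative_restrict, h, Polynomial.derivative_zero]

theorem iterate_derivative_restrict (l : NullLine R) (P : MvPolynomial (Fin 3) R) (k : ℕ) :
    Polynomial.derivative^[k] (l.restrict P) = l.restrict ((dirDeriv l.x)^[k] P) := by
  induction k with
  | zero => rfl
  | succ k ih => rw [Function.iterate_succ_apply', ih, derivative_restrict,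
      Function.iterate_succ_apply']

theorem eval_eq_zero_of_restrict {l : NullLine R} {P : MvPolynomial (Fin 3) R}
    (h : l.restrict P = 0) (t : R) : eval (l.point t) P = 0 := by
  rw [← eval_restrict, h, Polynomial.eval_zero]

/-- A line that touches a doubly ruled surface to first order is contained in it. -/
theorem restrict_eq_zero_of_contact [IsDomain R] {P : MvPolynomial (Fin 3) R}
    (hR : P ∣ contactLead P) (hR' : P ∣ contactConst P) (l : NullLine R) (t : R)
    (hchar : ∀ n : ℕ, 0 < n → n ≤ P.totalDegree → (n : R) ≠ 0)
    (h0 : eval (l.point t) P = 0) (h1 : eval (l.point t) (dirDeriv l.x P) = 0)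
    (h2 : eval (l.point t) (pderiv 2 P) ≠ 0) : l.restrict P = 0 := by
  have hmem : pderiv 2 P ^ 3 * dirDeriv l.x (dirDeriv l.x P) ∈
      Ideal.span {P, dirDeriv l.x P} := by
    obtain ⟨S, hS⟩ := exists_contact_division l.x P
    obtain ⟨u, hu⟩ := hR
    obtain ⟨v, hv⟩ := hR'
    rw [Ideal.mem_span_pair]
    refine ⟨u * C l.x + v, S, ?_⟩
    rw [hS]
    linear_combination - C l.x * hu - hv
  apply Polynomial.eq_zero_of_hasseDeriv_eq_zero _ t
  intro k
  by_cases hk : k ≤ P.totalDegree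
  · obtain ⟨n, hn⟩ := (dirDeriv l.x).exists_pow_mul_iterate_mem rfl hmem k
    obtain ⟨a, b, hab⟩ := Ideal.mem_span_pair.1 hn
    have h3 := congrArg (eval (l.point t)) hab
    simp only [map_add, map_mul, map_pow, h0, h1, mul_zero, add_zero] at h3
    have h4 := (mul_eq_zero.1 h3.symm).resolve_left (pow_ne_zero _ h2)
    rw [← eval_restrict, ← iterate_derivative_restrict, ← Polynomial.factorial_smul_hasseDeriv,
      LinearMap.smul_apply, Polynomial.eval_smul, nsmul_eq_mul] at h4
    refine (mul_eq_zero.1 h4).resolve_left ?_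
    clear h4 h3 hab hn
    induction k with
    | zero => simp
    | succ k ih =>
      rw [Nat.factorial_succ, Nat.cast_mul]
      exact mul_ne_zero (hchar _ (Nat.succ_pos _) hk) (ih (by omega))
  · rw [Polynomial.hasseDeriv_eq_zero_of_lt_natDegree _ _
      ((natDegree_restrict_le _ _).trans_lt (by omega)), Polynomial.eval_zero]

/-- Two null lines meet at a common time. -/
def Meets (l m : NullLine R) : Prop :=
  ∃ t, l.point t = m.point t

theorem point_eq_iff {l m : NullLine R} {t : R} : l.point t = m.point t ↔
    l.x * t + l.y = m.x * t + m.y ∧ l.x ^ 2 * t + l.z = m.x ^ 2 * t + m.z := by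
  simp [point]

/-- At a crossing of two lines in a surface, the gradient is determined by its last entry. -/
theorem gradient_of_crossing [IsDomain R] {l m : NullLine R} {P : MvPolynomial (Fin 3) R} {t : R}
    (hx : l.x ≠ m.x) (hl : l.restrict P = 0) (hm : m.restrict P = 0)
    (h : l.point t = m.point t) :
    eval (m.point t) (pderiv 1 P) = -(l.x + m.x) * eval (m.point t) (pderiv 2 P) ∧
      eval (m.point t) (pderiv 0 P) = l.x * m.x * eval (m.point t) (pderiv 2 P) := by
  have h1 := eval_eq_zero_of_restrict (restrict_dirDeriv_eq_zero hl) t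
  have h2 := eval_eq_zero_of_restrict (restrict_dirDeriv_eq_zero hm) t
  rw [h] at h1
  simp only [dirDeriv_apply, map_add, map_mul, eval_C] at h1 h2
  have h3 : eval (m.point t) (pderiv 1 P) = -(l.x + m.x) * eval (m.point t) (pderiv 2 P) := by
    apply mul_left_cancel₀ (sub_ne_zero.2 hx)
    linear_combination h1 - h2
  refine ⟨h3, ?_⟩
  linear_combination h2 - m.x * h3

theorem contact_eq_zero_of_crossing [IsDomain R] {l m : NullLine R} {P : MvPolynomial (Fin 3) R}
    {t : R} (hx : l.x ≠ m.x) (hl : l.restrict P = 0) (hm : m.restrict P = 0)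
    (h : l.point t = m.point t) :
    eval (m.point t) (contactLead P) = 0 ∧ eval (m.point t) (contactConst P) = 0 := by
  have key : ∀ n : NullLine R, n.restrict P = 0 →
      eval (n.point t) (contactLead P) * n.x + eval (n.point t) (contactConst P) = 0 := by
    intro n hn
    obtain ⟨S, hS⟩ := exists_contact_division n.x P
    have h0 := congrArg (eval (n.point t)) hS
    simp only [map_add, map_mul, eval_C, map_pow,
      eval_eq_zero_of_restrict (restrict_dirDeriv_eq_zero hn),
      eval_eq_zero_of_restrict (restrict_dirDeriv_eq_zero (restrict_dirDeriv_eq_zero hn))] at h0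
    linear_combination - h0
  have h1 := key l hl
  have h2 := key m hm
  rw [h] at h1
  have h3 : eval (m.point t) (contactLead P) = 0 := by
    apply mul_left_cancel₀ (sub_ne_zero.2 hx)
    linear_combination h1 - h2
  exact ⟨h3, by simpa [h3] using h2⟩

end CommRing

end NullLine

namespace NullLine

open MvPolynomial

section Map

variable {R S : Type*} [CommRing R] [CommRing S]

/-- Two null lines with distinct slopes meet as soon as one quadratic relation holds. -/
theorem meets_of_relation {F : Type*} [Field F] {l m : NullLine F} (hx : l.x ≠ m.x) (s : F)
    (h : l.x * (m.y - (l.point s) 1 + m.x * s) + m.x * (m.y - (l.point s) 1)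
      + (l.point s) 2 - m.z = 0) : l.Meets m := by
  have hx' := sub_ne_zero.2 hx
  simp only [point, Matrix.cons_val] at h
  have ht : (l.x - m.x) * ((m.y - l.y) / (l.x - m.x)) = m.y - l.y := by field_simp
  refine ⟨(m.y - l.y) / (l.x - m.x), point_eq_iff.2 ⟨?_, ?_⟩⟩
  · linear_combination ht
  · linear_combination (l.x + m.x) * ht + h

/-- The ring homomorphism sending a polynomial to its expansion at a point as a power series. -/
noncomputable def expandAt {F : Type*} [Field F] (s : F) : Polynomial F →+* PowerSeries F :=
  Polynomial.coeToPowerSeries.ringHom.comp (Polynomial.taylorAlgHom s).toRingHom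

theorem expandAt_injective {F : Type*} [Field F] (s : F) : Function.Injective (expandAt s) :=
  (Polynomial.coe_injective F).comp (Polynomial.taylor_injective s)

theorem constantCoeff_expandAt {F : Type*} [Field F] (s : F) (g : Polynomial F) :
    PowerSeries.constantCoeff (expandAt s g) = g.eval s := by
  simp [expandAt, Polynomial.taylor_coeff_zero]

theorem expandAt_C {F : Type*} [Field F] (s a : F) :
    expandAt s (Polynomial.C a) = PowerSeries.C a := by
  simp [expandAt]

theorem hom_restrict (ι : Polynomial R →+* S) (f : R →+* S) (hf : ∀ a, ι (Polynomial.C a) = f a)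
    (m : NullLine R) (P : MvPolynomial (Fin 3) R) :
    ι (m.restrict P) =
      eval ![ι Polynomial.X, f m.x * ι Polynomial.X + f m.y, f m.x ^ 2 * ι Polynomial.X + f m.z]
      (map f P) := by
  induction P using MvPolynomial.induction_on with
  | C a => simp [restrict, hf, Polynomial.algebraMap_eq]
  | add p q hp hq => simp [hp, hq]
  | mul_X p i hp =>
    rw [map_mul, map_mul, hp, map_mul, map_mul]
    congr 1
    fin_cases i <;> simp [restrict, hf]

theorem restrict_C (l : NullLine R) (a : R) : l.restrict (C a) = Polynomial.C a := by
  simp [restrict, Polynomial.algebraMap_eq]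

theorem restrict_map {l : NullLine R} (f : R →+* S) (P : MvPolynomial (Fin 3) R) :
    (⟨f l.x, f l.y, f l.z⟩ : NullLine S).restrict (map f P) = (l.restrict P).map f := by
  induction P using MvPolynomial.induction_on with
  | C a => simp [restrict, Polynomial.algebraMap_eq]
  | add p q hp hq => simp [hp, hq]
  | mul_X p i hp =>
    rw [map_mul, map_mul, hp, map_mul, Polynomial.map_mul]
    congr 1
    fin_cases i <;> simp [restrict]

end Map

variable {F : Type*} [Field F]

/-- On a doubly ruled surface, a line meeting `m₁` transversally moves along `m₁` to another line
and keeps meeting every line that it met at a smooth point. -/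
theorem meets_of_doubly_ruled_aux {O : Type*} [CommRing O] [IsDomain O]
    (κ : O →+* F) (f : F →+* O) (ι : Polynomial F →+* O) (hκC : ∀ a, κ (f a) = a)
    (hunit : ∀ w, κ w ≠ 0 → IsUnit w) (hιC : ∀ a, ι (Polynomial.C a) = f a)
    (hιinj : Function.Injective ι) {P : MvPolynomial (Fin 3) F}
    (hR : P ∣ contactLead P) (hR' : P ∣ contactConst P)
    (hchar : ∀ n : ℕ, 0 < n → n ≤ P.totalDegree → (n : F) ≠ 0)
    {l l' m₁ m₂ : NullLine F} (hl : l.restrict P = 0) (hl' : l'.restrict P = 0)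
    (hm₁ : m₁.restrict P = 0) (hm₂ : m₂.restrict P = 0)
    (h11 : l.x ≠ m₁.x) (h12 : l.x ≠ m₂.x) (h21 : l'.x ≠ m₁.x) (h22 : l'.x ≠ m₂.x)
    {t₁ t₂ t' : F} (hκι : ∀ g, κ (ι g) = g.eval t₁) (ht₁ : l.point t₁ = m₁.point t₁)
    (ht₂ : l.point t₂ = m₂.point t₂)
    (ht' : l'.point t' = m₁.point t') (hz₁ : eval (m₁.point t₁) (pderiv 2 P) ≠ 0)
    (hz₂ : eval (m₂.point t₂) (pderiv 2 P) ≠ 0) (hz' : eval (m₁.point t') (pderiv 2 P) ≠ 0) :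
    l'.Meets m₂ := by
  set P' := map (f) P with hP'
  set s := ι Polynomial.X with hs
  set α := m₁.restrict (pderiv 2 P) with hα
  set β := m₁.restrict (pderiv 1 P) with hβ
  set γ := m₁.restrict (pderiv 0 P) with hγ
  have hαβγ : Polynomial.C (m₁.x ^ 2) * α + Polynomial.C m₁.x * β + γ = 0 := by
    have := restrict_dirDeriv_eq_zero hm₁
    rwa [dirDeriv_apply, map_add, map_add, map_mul, map_mul, restrict_C, restrict_C] at this
  have hκs : κ s = t₁ := by rw [hs, hκι, Polynomial.eval_X]
  have hκα : κ (ι α) = eval (m₁.point t₁) (pderiv 2 P) := by rw [hκι, eval_restrict]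
  have hκβ : κ (ι β) = -(l.x + m₁.x) * eval (m₁.point t₁) (pderiv 2 P) := by
    rw [hκι, eval_restrict]
    exact (gradient_of_crossing h11 hl hm₁ ht₁).1
  obtain ⟨a', ha'⟩ := (hunit (ι α) (hκα ▸ hz₁)).exists_right_inv
  set x₁ := f m₁.x with hx₁
  set x₂ := f m₂.x with hx₂
  set ξ := -a' * ι β - x₁ with hξ
  have haξ : ι α * ξ = -ι β - x₁ * ι α := by
    rw [hξ]
    linear_combination - ι β * ha'
  have hκξ : κ ξ = l.x := by
    have h1 := congrArg κ haξ
    simp only [map_mul, map_sub, map_neg, hκα, hκβ, hx₁, hκC] at h1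
    apply mul_left_cancel₀ hz₁
    linear_combination h1
  set vy := x₁ * s + f m₁.y with hvy
  set vz := x₁ ^ 2 * s + f m₁.z with hvz
  set lam : NullLine (O) := ⟨ξ, vy - ξ * s, vz - ξ ^ 2 * s⟩ with hlam
  have hpt : lam.point s = ![s, vy, vz] := by simp [hlam, point]
  have hexp : ∀ Q, ι (m₁.restrict Q) = eval ![s, vy, vz] (map f Q) :=
    hom_restrict ι f hιC m₁
  have hlam0 : lam.restrict P' = 0 := by
    refine restrict_eq_zero_of_contact ?_ ?_ lam s ?_ ?_ ?_ ?_
    · rw [hP', ← map_contactLead]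
      exact _root_.map_dvd _ hR
    · rw [hP', ← map_contactConst]
      exact _root_.map_dvd _ hR'
    · intro n hn hn' h0
      refine hchar n hn (hn'.trans (Finset.sup_mono (support_map_subset f P))) ?_
      simpa using congrArg κ h0
    · rw [hpt, hP', ← hexp, hm₁, map_zero]
    · rw [hpt, dirDeriv_apply, hP', pderiv_map, pderiv_map, pderiv_map]
      simp only [map_add, map_mul, eval_C, ← hexp]
      have h1 := congrArg ι hαβγ
      simp only [map_add, map_mul, map_zero, hιC] at h1
      simp only [map_pow, ← hα, ← hβ, ← hγ] at h1 ⊢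
      change ξ ^ 2 * _ + ξ * _ + _ = 0
      linear_combination h1 + (ξ - x₁) * haξ
    · rw [hpt, hP', pderiv_map, ← hexp, ← hα]
      intro h0
      rw [h0, map_zero] at hκα
      exact hz₁ hκα.symm
  have hκξ₂ : κ (ξ - x₂) ≠ 0 := by
    rw [map_sub, hκξ, hx₂, hκC]
    exact sub_ne_zero.2 h12
  obtain ⟨r, hr⟩ := (hunit _ hκξ₂).exists_right_inv
  set τ := r * (f m₂.y - vy + ξ * s) with hτ
  have hτeq : (ξ - x₂) * τ = f m₂.y - vy + ξ * s := by
    rw [hτ, ← mul_assoc, hr, one_mul]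
  obtain ⟨h2y, h2z⟩ := point_eq_iff.1 ht₂
  obtain ⟨h1y, h1z⟩ := point_eq_iff.1 ht₁
  have hκτ : κ τ = t₂ := by
    have h1 := congrArg κ hτeq
    simp only [map_mul, map_sub, map_add, hκξ, hx₂, hκC, hvy, hx₁, hκs] at h1
    apply mul_left_cancel₀ (sub_ne_zero.2 h12)
    linear_combination h1 - h2y + h1y
  set m₂' : NullLine (O) := ⟨x₂, f m₂.y, f m₂.z⟩ with hm₂'
  have hm₂0 : m₂'.restrict P' = 0 := by
    rw [hm₂', hP', hx₂, restrict_map, hm₂, Polynomial.map_zero]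
  set Z := ξ ^ 2 * τ + (vz - ξ ^ 2 * s) with hZ
  set Z' := x₂ ^ 2 * τ + f m₂.z with hZ'
  set Y := x₂ * τ + f m₂.y with hY
  have hpl : lam.point τ = ![τ, Y, Z' + (Z - Z')] := by
    have h1 : ξ * τ + (vy - ξ * s) = Y := by rw [hY]; linear_combination hτeq
    simp [hlam, point, h1, hZ]
  have hpm : m₂'.point τ = ![τ, Y, Z'] := by simp [hm₂', point, hY, hZ']
  obtain ⟨w, hw⟩ := exists_eval_add_third P' τ Y Z' (Z - Z')
  rw [← hpl, ← hpm, eval_eq_zero_of_restrict hlam0, eval_eq_zero_of_restrict hm₂0, zero_add] at hw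
  have hκZ : κ (Z - Z') = 0 := by
    simp only [hZ, hZ', map_sub, map_add, map_mul, map_pow, hκξ, hκτ, hvz, hx₁, hx₂, hκC, hκs]
    linear_combination h2z - h1z
  have hκPz : κ (eval (m₂'.point τ) (pderiv 2 P')) = eval (m₂.point t₂) (pderiv 2 P) := by
    rw [hP', pderiv_map, eval_map, eval, coe_eval₂Hom, hom_eval₂]
    congr 1
    · ext a
      simp [hκC]
    · funext i
      fin_cases i <;> simp [point, hm₂', hκτ, hx₂, hκC]
  have hZZ : Z - Z' = 0 := by
    refine (mul_eq_zero.1 hw.symm).resolve_right fun h0 => hz₂ ?_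
    have h1 := congrArg κ h0
    rw [map_add, hκPz, map_mul, hκZ, zero_mul, add_zero, map_zero] at h1
    exact h1
  have hrel : ξ * (f m₂.y - vy + x₂ * s) + x₂ * (f m₂.y - vy) + vz
      - f m₂.z = 0 := by
    linear_combination hZZ - (ξ + x₂) * hτeq
  set Vy := Polynomial.C m₁.x * Polynomial.X + Polynomial.C m₁.y with hVy
  set Vz := Polynomial.C m₁.x ^ 2 * Polynomial.X + Polynomial.C m₁.z with hVz
  have hpoly : (-β - Polynomial.C m₁.x * α) * (Polynomial.C m₂.y - Vy
      + Polynomial.C m₂.x * Polynomial.X)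
      + α * (Polynomial.C m₂.x * (Polynomial.C m₂.y - Vy) + Vz - Polynomial.C m₂.z) = 0 := by
    apply hιinj
    rw [map_zero]
    simp only [hVy, hVz, map_add, map_mul, map_sub, map_neg, map_pow, ← hs]
    simp only [hιC]
    rw [← hx₁, ← hx₂, ← hvy, ← hvz]
    linear_combination ι α * hrel - (f m₂.y - vy + x₂ * s) * haξ
  have hev := congrArg (Polynomial.eval t') hpoly
  obtain ⟨h'y, h'z⟩ := point_eq_iff.1 ht'
  simp only [Polynomial.eval_add, Polynomial.eval_mul, Polynomial.eval_sub, Polynomial.eval_neg,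
    Polynomial.eval_C, Polynomial.eval_X, Polynomial.eval_pow, hVy, hVz, hα, hβ, eval_restrict,
    (gradient_of_crossing h21 hl' hm₁ ht').1, Polynomial.eval_zero] at hev
  apply meets_of_relation h22 t'
  simp only [point, Matrix.cons_val]
  apply mul_left_cancel₀ hz'
  rw [mul_zero, ← hev, h'y, h'z]
  ring

theorem meets_of_doubly_ruled {P : MvPolynomial (Fin 3) F}
    (hR : P ∣ contactLead P) (hR' : P ∣ contactConst P)
    (hchar : ∀ n : ℕ, 0 < n → n ≤ P.totalDegree → (n : F) ≠ 0)
    {l l' m₁ m₂ : NullLine F} (hl : l.restrict P = 0) (hl' : l'.restrict P = 0)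
    (hm₁ : m₁.restrict P = 0) (hm₂ : m₂.restrict P = 0)
    (h11 : l.x ≠ m₁.x) (h12 : l.x ≠ m₂.x) (h21 : l'.x ≠ m₁.x) (h22 : l'.x ≠ m₂.x)
    {t₁ t₂ t' : F} (ht₁ : l.point t₁ = m₁.point t₁) (ht₂ : l.point t₂ = m₂.point t₂)
    (ht' : l'.point t' = m₁.point t') (hz₁ : eval (m₁.point t₁) (pderiv 2 P) ≠ 0)
    (hz₂ : eval (m₂.point t₂) (pderiv 2 P) ≠ 0) (hz' : eval (m₁.point t') (pderiv 2 P) ≠ 0) :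
    l'.Meets m₂ := by
  exact meets_of_doubly_ruled_aux PowerSeries.constantCoeff PowerSeries.C (expandAt t₁)
    PowerSeries.constantCoeff_C
    (fun w hw => PowerSeries.isUnit_iff_constantCoeff.2 (isUnit_iff_ne_zero.2 hw))
    (expandAt_C t₁) (expandAt_injective t₁) hR hR' hchar hl hl' hm₁ hm₂ h11 h12 h21 h22
    (constantCoeff_expandAt t₁) ht₁ ht₂ ht' hz₁ hz₂ hz'

end NullLine

namespace Finset

variable {α β : Type*}

theorem card_le_mul_of_fibers_fst {T : Finset (α × β)} {L : Finset α} {n : ℕ}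
    (hL : ∀ q ∈ T, q.1 ∈ L)
    (h : ∀ a ∈ L, ∀ S : Finset β, (∀ b ∈ S, (a, b) ∈ T) → S.card ≤ n) :
    T.card ≤ n * L.card := by
  refine Finset.card_le_mul_card_image_of_maps_to hL n fun a ha => ?_
  have hinj : Set.InjOn Prod.snd ((T.filter fun q => q.1 = a : Finset (α × β)) : Set (α × β)) := by
    intro q hq q' hq' hqq
    rw [mem_coe, mem_filter] at hq hq'
    exact Prod.ext (hq.2.trans hq'.2.symm) hqq
  rw [← card_image_of_injOn hinj]
  refine h a ha _ fun b hb => ?_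
  obtain ⟨q, hq, rfl⟩ := mem_image.1 hb
  obtain ⟨hq', rfl⟩ := mem_filter.1 hq
  exact hq'

theorem card_le_mul_of_fibers_snd {T : Finset (α × β)} {M : Finset β} {n : ℕ}
    (hM : ∀ q ∈ T, q.2 ∈ M)
    (h : ∀ b ∈ M, ∀ S : Finset α, (∀ a ∈ S, (a, b) ∈ T) → S.card ≤ n) :
    T.card ≤ n * M.card := by
  rw [← card_map (Equiv.prodComm α β).toEmbedding]
  refine card_le_mul_of_fibers_fst ?_ fun b hb S hS => h b hb S fun a ha => ?_
  · rintro q hq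
    obtain ⟨q, hq', rfl⟩ := mem_map.1 hq
    exact hM _ hq'
  · obtain ⟨q, hq, hqe⟩ := mem_map.1 (hS a ha)
    obtain ⟨rfl, rfl⟩ := Prod.ext_iff.1 hqe
    exact hq

end Finset

namespace MvPolynomial

variable {F : Type*} [Field F]

theorem not_dvd_of_totalDegree_lt {σ : Type*} {P Q : MvPolynomial σ F} (hQ : Q ≠ 0)
    (h : Q.totalDegree < P.totalDegree) : ¬ P ∣ Q := by
  rintro ⟨c, rfl⟩
  rw [totalDegree_mul_of_isDomain (left_ne_zero_of_mul hQ) (right_ne_zero_of_mul hQ)] at h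
  omega

theorem totalDegree_pos_of_prime {σ : Type*} {P : MvPolynomial σ F} (hP : Prime P) :
    0 < P.totalDegree := by
  rw [Nat.pos_iff_ne_zero]
  intro h
  have h1 := totalDegree_eq_zero_iff_eq_C.1 h
  refine hP.not_isUnit ?_
  rw [h1]
  refine (isUnit_iff_ne_zero.2 fun h2 => hP.ne_zero ?_).map C
  rw [h1, h2, C_0]

theorem totalDegree_eq_zero_of_pderiv {σ : Type*} {P : MvPolynomial σ F}
    (hchar : ∀ n : ℕ, 0 < n → n ≤ P.totalDegree → (n : F) ≠ 0)
    (h : ∀ i, pderiv i P = 0) : P.totalDegree = 0 := by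
  rw [totalDegree_eq_zero_iff]
  intro n hn i
  by_contra hi
  have h1 : n - Finsupp.single i 1 + Finsupp.single i 1 = n :=
    tsub_add_cancel_of_le (by simpa using Nat.one_le_iff_ne_zero.2 hi)
  have h2 := coeff_pderiv (i := i) P (n - Finsupp.single i 1)
  rw [h, h1, coeff_zero] at h2
  have h3 : ((n - Finsupp.single i 1 : σ →₀ ℕ) i : F) + 1 = (n i : F) := by
    conv_rhs => rw [← h1]
    rw [Finsupp.add_apply, Finsupp.single_eq_same, Nat.cast_add, Nat.cast_one]
  rw [h3] at h2
  refine (mul_ne_zero (mem_support_iff.1 hn) (hchar _ (Nat.pos_of_ne_zero hi) ?_)) h2.symm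
  refine le_trans ?_ (le_totalDegree hn)
  rw [Finsupp.sum]
  exact Finset.single_le_sum (f := fun j => n j) (fun _ _ => Nat.zero_le _)
    (Finsupp.mem_support_iff.2 hi)

end MvPolynomial

namespace NullLine

open MvPolynomial

variable {F : Type*} [Field F]

/-- The pairs of meeting lines. -/
noncomputable def crossings (L M : Finset (NullLine F)) : Finset (NullLine F × NullLine F) :=
  (L ×ˢ M).filter fun q => q.1.Meets q.2

theorem mem_crossings {L M : Finset (NullLine F)} {q : NullLine F × NullLine F} :
    q ∈ crossings L M ↔ (q.1 ∈ L ∧ q.2 ∈ M) ∧ q.1.Meets q.2 := by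
  simp [crossings]

theorem crossings_mono {L M L' M' : Finset (NullLine F)} (hL : L ⊆ L') (hM : M ⊆ M') :
    crossings L M ⊆ crossings L' M' := by
  intro q
  simp only [mem_crossings]
  exact fun h => ⟨⟨hL h.1.1, hM h.1.2⟩, h.2⟩

/-- Two families of pairwise skew null lines with distinct slopes, such that any two lines of the
first family have at most `k` common neighbours in the second. -/
structure Admissible (L M : Finset (NullLine F)) (k : ℕ) : Prop where
  skew_left : ∀ l ∈ L, ∀ l' ∈ L, l.Meets l' → l = l'
  skew_right : ∀ m ∈ M, ∀ m' ∈ M, m.Meets m' → m = m'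
  slope_ne : ∀ l ∈ L, ∀ m ∈ M, l.x ≠ m.x
  codegree : ∀ l ∈ L, ∀ l' ∈ L, l ≠ l' →
    (M.filter fun m => l.Meets m ∧ l'.Meets m).card ≤ k

theorem Admissible.mono {L M L' M' : Finset (NullLine F)} {k : ℕ} (h : Admissible L M k)
    (hL : L' ⊆ L) (hM : M' ⊆ M) : Admissible L' M' k where
  skew_left l hl l' hl' := h.skew_left l (hL hl) l' (hL hl')
  skew_right l hl l' hl' := h.skew_right l (hM hl) l' (hM hl')
  slope_ne l hl m hm := h.slope_ne l (hL hl) m (hM hm)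
  codegree l h₁ m h₂ hne := (Finset.card_le_card (Finset.filter_subset_filter _ hM)).trans
    (h.codegree l (hL h₁) m (hL h₂) hne)

/-- A line off a surface meets few pairwise skew lines at points of the surface. -/
theorem card_le_totalDegree {S : Finset (NullLine F)} {m : NullLine F}
    {Q : MvPolynomial (Fin 3) F} (hS : ∀ l ∈ S, ∀ l' ∈ S, l.Meets l' → l = l')
    (hm : m.restrict Q ≠ 0)
    (h : ∀ l ∈ S, ∃ t, l.point t = m.point t ∧ eval (m.point t) Q = 0) :
    S.card ≤ Q.totalDegree := by
  choose! t ht using h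
  refine le_trans (Finset.card_le_card_of_injOn t (t := (m.restrict Q).roots.toFinset) ?_ ?_)
    ((Multiset.toFinset_card_le _).trans
      ((Polynomial.card_roots' _).trans (natDegree_restrict_le _ _)))
  · intro l hl
    simp only [Finset.mem_coe, Multiset.mem_toFinset, Polynomial.mem_roots hm, Polynomial.IsRoot]
    rw [eval_restrict]
    exact (ht l hl).2
  · intro l₁ h₁ l₂ h₂ h₁₂
    exact hS l₁ h₁ l₂ h₂ ⟨t l₁, by rw [(ht l₁ h₁).1, h₁₂, (ht l₂ h₂).1]⟩

/-- Few crossings lie on a surface, other than crossings of lines contained in it. -/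
theorem card_crossings_on_surface_le {L M : Finset (NullLine F)} {k : ℕ}
    (h : Admissible L M k) (W : MvPolynomial (Fin 3) F) :
    ((L ×ˢ M).filter fun q => ∃ t, q.1.point t = q.2.point t ∧ eval (q.2.point t) W = 0).card ≤
      W.totalDegree * L.card + W.totalDegree * M.card +
        (crossings (L.filter fun l => l.restrict W = 0)
          (M.filter fun m => m.restrict W = 0)).card := by
  set T := (L ×ˢ M).filter fun q => ∃ t, q.1.point t = q.2.point t ∧ eval (q.2.point t) W = 0
    with hT
  have hmem : ∀ q, q ∈ T ↔ (q.1 ∈ L ∧ q.2 ∈ M) ∧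
      ∃ t, q.1.point t = q.2.point t ∧ eval (q.2.point t) W = 0 := by
    intro q
    simp [hT]
  have hsub : T ⊆ (T.filter fun q => q.1.restrict W ≠ 0) ∪ (T.filter fun q => q.2.restrict W ≠ 0) ∪
      crossings (L.filter fun l => l.restrict W = 0) (M.filter fun m => m.restrict W = 0) := by
    intro q hq
    have hq' := (hmem q).1 hq
    simp only [Finset.mem_union, Finset.mem_filter, mem_crossings]
    by_cases h1 : q.1.restrict W = 0
    · by_cases h2 : q.2.restrict W = 0
      · exact Or.inr ⟨⟨⟨hq'.1.1, h1⟩, ⟨hq'.1.2, h2⟩⟩, hq'.2.imp fun t ht => ht.1⟩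
      · exact Or.inl (Or.inr ⟨hq, h2⟩)
    · exact Or.inl (Or.inl ⟨hq, h1⟩)
  refine (Finset.card_le_card hsub).trans ((Finset.card_union_le _ _).trans
    (add_le_add ((Finset.card_union_le _ _).trans (add_le_add ?_ ?_)) le_rfl))
  · refine Finset.card_le_mul_of_fibers_fst
      (fun q hq => ((hmem q).1 (Finset.mem_filter.1 hq).1).1.1) fun l hl S hS => ?_
    rcases S.eq_empty_or_nonempty with rfl | ⟨b, hb⟩
    · simp
    refine card_le_totalDegree (m := l) (fun m hm m' hm' => ?_)
      (Finset.mem_filter.1 (hS b hb)).2 fun m hm => ?_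
    · exact h.skew_right m ((hmem _).1 (Finset.mem_filter.1 (hS m hm)).1).1.2
        m' ((hmem _).1 (Finset.mem_filter.1 (hS m' hm')).1).1.2
    · obtain ⟨t, ht, ht'⟩ := ((hmem _).1 (Finset.mem_filter.1 (hS m hm)).1).2
      exact ⟨t, ht.symm, by rw [ht]; exact ht'⟩
  · refine Finset.card_le_mul_of_fibers_snd
      (fun q hq => ((hmem q).1 (Finset.mem_filter.1 hq).1).1.2) fun m hm S hS => ?_
    rcases S.eq_empty_or_nonempty with rfl | ⟨b, hb⟩
    · simp
    refine card_le_totalDegree (m := m) (fun l hl l' hl' => ?_)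
      (Finset.mem_filter.1 (hS b hb)).2 fun l hl => ?_
    · exact h.skew_left l ((hmem _).1 (Finset.mem_filter.1 (hS l hl)).1).1.1
        l' ((hmem _).1 (Finset.mem_filter.1 (hS l' hl')).1).1.1
    · exact ((hmem _).1 (Finset.mem_filter.1 (hS l hl)).1).2

/-- A set of crossings closed under transport along lines is small. -/
theorem card_le_of_transport {L M : Finset (NullLine F)} {k : ℕ} (h : Admissible L M k)
    {T : Finset (NullLine F × NullLine F)} (hT : T ⊆ crossings L M)
    (htr : ∀ l l' m₁ m₂, (l, m₁) ∈ T → (l, m₂) ∈ T → (l', m₁) ∈ T → l'.Meets m₂) :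
    T.card ≤ k * L.card + M.card := by
  have hmem : ∀ {l m}, (l, m) ∈ T → (l ∈ L ∧ m ∈ M) ∧ l.Meets m := fun hq =>
    mem_crossings.1 (hT hq)
  have hsplit := Finset.card_filter_add_card_filter_not (s := T)
    (fun q => ∃ l', l' ≠ q.1 ∧ (l', q.2) ∈ T)
  have h1 : (T.filter fun q => ∃ l', l' ≠ q.1 ∧ (l', q.2) ∈ T).card ≤ k * L.card := by
    refine Finset.card_le_mul_of_fibers_fst
      (fun q hq => (hmem (Finset.mem_filter.1 hq).1).1.1) fun l hl S hS => ?_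
    rcases S.eq_empty_or_nonempty with rfl | ⟨b, hb⟩
    · simp
    obtain ⟨hlb, l', hl', hl'b⟩ := Finset.mem_filter.1 (hS b hb)
    refine (Finset.card_le_card fun m hm => ?_).trans
      (h.codegree l hl l' (hmem hl'b).1.1 hl'.symm)
    have hlm := (Finset.mem_filter.1 (hS m hm)).1
    exact Finset.mem_filter.2 ⟨(hmem hlm).1.2, (hmem hlm).2, htr l l' b m hlb hlm hl'b⟩
  have h2 : (T.filter fun q => ¬ ∃ l', l' ≠ q.1 ∧ (l', q.2) ∈ T).card ≤ 1 * M.card := by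
    refine Finset.card_le_mul_of_fibers_snd
      (fun q hq => (hmem (Finset.mem_filter.1 hq).1).1.2) fun m hm S hS => ?_
    refine Finset.card_le_one.2 fun a ha b hb => ?_
    by_contra hab
    exact (Finset.mem_filter.1 (hS a ha)).2 ⟨b, fun h => hab h.symm,
      (Finset.mem_filter.1 (hS b hb)).1⟩
  omega

/-- On an irreducible surface, all crossings but a controlled number lie on another surface. -/
theorem exists_second_surface {P : MvPolynomial (Fin 3) F} (hP : Prime P)
    (hchar : ∀ n : ℕ, 0 < n → n ≤ P.totalDegree → (n : F) ≠ 0)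
    {L M : Finset (NullLine F)} {k : ℕ} (h : Admissible L M k)
    (hL : ∀ l ∈ L, l.restrict P = 0) (hM : ∀ m ∈ M, m.restrict P = 0) :
    ∃ W : MvPolynomial (Fin 3) F, ¬ P ∣ W ∧ W.totalDegree ≤ 5 * P.totalDegree ∧
      ((crossings L M).filter fun q => ∀ t, q.1.point t = q.2.point t →
        eval (q.2.point t) W ≠ 0).card ≤ k * L.card + M.card := by
  have hpos := totalDegree_pos_of_prime hP
  have hdeg := fun i => totalDegree_pderiv_le i P
  have hempty : ∀ W : MvPolynomial (Fin 3) F,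
      (∀ l ∈ L, ∀ m ∈ M, ∀ t, l.point t = m.point t → eval (m.point t) W = 0) →
      ((crossings L M).filter fun q => ∀ t, q.1.point t = q.2.point t →
        eval (q.2.point t) W ≠ 0).card ≤ k * L.card + M.card := by
    intro W hW
    rw [Finset.filter_false_of_mem]
    · simp
    · intro q hq hq'
      obtain ⟨⟨hq1, hq2⟩, t, ht⟩ := mem_crossings.1 hq
      exact hq' t ht (hW _ hq1 _ hq2 t ht)
  by_cases hz : pderiv 2 P = 0
  · have hgrad : ∀ l ∈ L, ∀ m ∈ M, ∀ t, l.point t = m.point t →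
        eval (m.point t) (pderiv 1 P) = 0 ∧ eval (m.point t) (pderiv 0 P) = 0 := by
      intro l hl m hm t ht
      simpa [hz] using gradient_of_crossing (h.slope_ne l hl m hm) (hL l hl) (hM m hm) ht
    by_cases hy : pderiv 1 P = 0
    · have ht : pderiv 0 P ≠ 0 := by
        intro ht
        refine hpos.ne' (totalDegree_eq_zero_of_pderiv hchar fun i => ?_)
        fin_cases i <;> assumption
      have := hdeg 0
      exact ⟨pderiv 0 P, not_dvd_of_totalDegree_lt ht (by omega), by omega,
        hempty _ fun l hl m hm t ht => (hgrad l hl m hm t ht).2⟩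
    · have := hdeg 1
      exact ⟨pderiv 1 P, not_dvd_of_totalDegree_lt hy (by omega), by omega,
        hempty _ fun l hl m hm t ht => (hgrad l hl m hm t ht).1⟩
  have hcon := totalDegree_contact_le P
  by_cases hR : P ∣ contactLead P
  · by_cases hR' : P ∣ contactConst P
    · have := hdeg 2
      refine ⟨pderiv 2 P, not_dvd_of_totalDegree_lt hz (by omega), by omega,
        card_le_of_transport h (Finset.filter_subset _ _) ?_⟩
      intro l l' m₁ m₂ h1 h2 h3
      obtain ⟨h1, h1'⟩ := Finset.mem_filter.1 h1
      obtain ⟨h2, h2'⟩ := Finset.mem_filter.1 h2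
      obtain ⟨h3, h3'⟩ := Finset.mem_filter.1 h3
      obtain ⟨⟨hl, hm₁⟩, t₁, ht₁⟩ := mem_crossings.1 h1
      obtain ⟨⟨-, hm₂⟩, t₂, ht₂⟩ := mem_crossings.1 h2
      obtain ⟨⟨hl', -⟩, t', ht'⟩ := mem_crossings.1 h3
      exact meets_of_doubly_ruled hR hR' hchar (hL _ hl) (hL _ hl') (hM _ hm₁) (hM _ hm₂)
        (h.slope_ne _ hl _ hm₁) (h.slope_ne _ hl _ hm₂) (h.slope_ne _ hl' _ hm₁)
        (h.slope_ne _ hl' _ hm₂) ht₁ ht₂ ht' (h1' _ ht₁) (h2' _ ht₂) (h3' _ ht')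
    · exact ⟨contactConst P, hR', by omega, hempty _ fun l hl m hm t ht =>
        (contact_eq_zero_of_crossing (h.slope_ne l hl m hm) (hL l hl) (hM m hm) ht).2⟩
  · exact ⟨contactLead P, hR, by omega, hempty _ fun l hl m hm t ht =>
        (contact_eq_zero_of_crossing (h.slope_ne l hl m hm) (hL l hl) (hM m hm) ht).1⟩

theorem card_crossings_le_of_prime {P : MvPolynomial (Fin 3) F} (hP : Prime P)
    (hchar : ∀ n : ℕ, 0 < n → n ≤ P.totalDegree → (n : F) ≠ 0)
    {L M : Finset (NullLine F)} {k : ℕ} (h : Admissible L M k)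
    (hL : ∀ l ∈ L, l.restrict P = 0) :
    ∃ L' ⊆ L, ∃ M' ⊆ M, L'.card ≤ 5 * P.totalDegree ^ 2 ∧ M'.card ≤ 5 * P.totalDegree ^ 2 ∧
      (crossings L M).card ≤ (5 * P.totalDegree + k) * L.card + 7 * P.totalDegree * M.card +
        (crossings L' M').card := by
  set e := P.totalDegree with he
  have hpos : 0 < e := totalDegree_pos_of_prime hP
  set N := M.filter fun m => m.restrict P = 0 with hN
  have hNM : N ⊆ M := Finset.filter_subset _ _
  have hN' := h.mono (Finset.Subset.refl L) hNM
  obtain ⟨W, hPW, hW, hgood⟩ := exists_second_surface hP hchar hN' hL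
    fun m hm => (Finset.mem_filter.1 hm).2
  have hbad := card_crossings_on_surface_le hN' W
  set L' := L.filter fun l => l.restrict W = 0
  set M' := N.filter fun m => m.restrict W = 0
  have hcard : ∀ X : Finset (NullLine F), (∀ l ∈ X, l.restrict P = 0) →
      (X.filter fun l => l.restrict W = 0).card ≤ 5 * e ^ 2 := by
    intro X hX
    have := card_le_of_prime hP hPW (X := X.filter fun l => l.restrict W = 0)
      (fun l hl => hX l (Finset.mem_filter.1 hl).1) fun l hl => (Finset.mem_filter.1 hl).2
    refine this.trans ?_
    calc e * W.totalDegree ≤ e * (5 * e) := Nat.mul_le_mul_left _ hW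
      _ = 5 * e ^ 2 := by ring
  refine ⟨L', Finset.filter_subset _ _, M', (Finset.filter_subset _ _).trans hNM,
    hcard L hL, hcard N fun m hm => (Finset.mem_filter.1 hm).2, ?_⟩
  have hoff : ((crossings L M).filter fun q => q.2.restrict P ≠ 0).card ≤ e * M.card := by
    refine Finset.card_le_mul_of_fibers_snd
      (fun q hq => (mem_crossings.1 (Finset.mem_filter.1 hq).1).1.2) fun m hm S hS => ?_
    rcases S.eq_empty_or_nonempty with rfl | ⟨b, hb⟩
    · simp
    have hS' : ∀ l ∈ S, l ∈ L := fun l hl =>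
      (mem_crossings.1 (Finset.mem_filter.1 (hS l hl)).1).1.1
    refine card_le_totalDegree (m := m)
      (fun l hl l' hl' => h.skew_left l (hS' l hl) l' (hS' l' hl'))
      (Finset.mem_filter.1 (hS b hb)).2 fun l hl => ?_
    obtain ⟨t, ht⟩ := (mem_crossings.1 (Finset.mem_filter.1 (hS l hl)).1).2
    exact ⟨t, ht, by rw [← ht]; exact eval_eq_zero_of_restrict (hL l (hS' l hl)) t⟩
  have hsub : crossings L M ⊆ ((crossings L M).filter fun q => q.2.restrict P ≠ 0) ∪
      (((crossings L N).filter fun q => ∀ t, q.1.point t = q.2.point t →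
        eval (q.2.point t) W ≠ 0) ∪
      ((L ×ˢ N).filter fun q => ∃ t, q.1.point t = q.2.point t ∧
        eval (q.2.point t) W = 0)) := by
    intro q hq
    have hq' := mem_crossings.1 hq
    simp only [Finset.mem_union, Finset.mem_filter]
    by_cases h1 : q.2.restrict P = 0
    · have hqN : q.2 ∈ N := Finset.mem_filter.2 ⟨hq'.1.2, h1⟩
      refine Or.inr ?_
      by_cases h2 : ∃ t, q.1.point t = q.2.point t ∧ eval (q.2.point t) W = 0
      · exact Or.inr ⟨Finset.mem_product.2 ⟨hq'.1.1, hqN⟩, h2⟩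
      · push Not at h2
        exact Or.inl ⟨mem_crossings.2 ⟨⟨hq'.1.1, hqN⟩, hq'.2⟩, h2⟩
    · exact Or.inl ⟨hq, h1⟩
  have h1 := (Finset.card_le_card hsub).trans (Finset.card_union_le _ _)
  have h2 := h1.trans (add_le_add le_rfl (Finset.card_union_le _ _))
  have h3 := Finset.card_le_card hNM
  have h4 : W.totalDegree * L.card ≤ 5 * e * L.card := Nat.mul_le_mul_right _ hW
  have h5 : W.totalDegree * N.card ≤ 5 * e * M.card := Nat.mul_le_mul hW h3
  have h6 : M.card ≤ e * M.card := Nat.le_mul_of_pos_left _ hpos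
  nlinarith

theorem crossings_union_left (L₁ L₂ M : Finset (NullLine F)) :
    crossings (L₁ ∪ L₂) M = crossings L₁ M ∪ crossings L₂ M := by
  ext q
  simp only [mem_crossings, Finset.mem_union]
  tauto

/-- Crossings on a surface: all but a controlled number are crossings of few lines. -/
theorem card_crossings_le_of_surface {P : MvPolynomial (Fin 3) F} (hP : P ≠ 0) {k : ℕ} :
    ∀ {L M : Finset (NullLine F)},
    (∀ n : ℕ, 0 < n → n ≤ P.totalDegree → (n : F) ≠ 0) → Admissible L M k →
    (∀ l ∈ L, l.restrict P = 0) →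
    ∃ L' ⊆ L, ∃ M' ⊆ M, L'.card ≤ 5 * P.totalDegree ^ 2 ∧ M'.card ≤ 5 * P.totalDegree ^ 2 ∧
      (crossings L M).card ≤ (5 * P.totalDegree + k) * L.card + 7 * P.totalDegree * M.card +
        (crossings L' M').card := by
  induction P using UniqueFactorizationMonoid.induction_on_prime with
  | h₁ => exact absurd rfl hP
  | h₂ u hu =>
    intro L M _ _ hL
    have : L = ∅ := by
      rw [Finset.eq_empty_iff_forall_notMem]
      intro l hl
      have := hu.map l.restrict
      rw [hL l hl] at this
      exact not_isUnit_zero this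
    subst this
    exact ⟨∅, by simp, ∅, by simp, by simp [crossings]⟩
  | h₃ a p ha hp ih =>
    intro L M hchar h hL
    have hdeg := totalDegree_mul_of_isDomain hp.ne_zero ha
    rw [hdeg] at hchar ⊢
    set d := p.totalDegree
    set f := a.totalDegree
    set L₁ := L.filter fun l => l.restrict p = 0 with hL₁
    set L₂ := L.filter fun l => ¬ l.restrict p = 0 with hL₂
    have hu : L₁ ∪ L₂ = L := Finset.filter_union_filter_not_eq _ _
    have hc : L₁.card + L₂.card = L.card := Finset.card_filter_add_card_filter_not _
    have hs₁ : L₁ ⊆ L := Finset.filter_subset _ _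
    have hs₂ : L₂ ⊆ L := Finset.filter_subset _ _
    obtain ⟨A, hA, B, hB, hAc, hBc, hI⟩ := card_crossings_le_of_prime hp
      (fun n hn hn' => hchar n hn (by omega)) (h.mono hs₁ (Finset.Subset.refl M))
      (fun l hl => (Finset.mem_filter.1 hl).2)
    obtain ⟨A', hA', B', hB', hAc', hBc', hI'⟩ := ih ha
      (fun n hn hn' => hchar n hn (by omega)) (h.mono hs₂ (Finset.Subset.refl M)) (by
        intro l hl
        obtain ⟨hl, hl'⟩ := Finset.mem_filter.1 hl
        have := hL l hl
        rw [map_mul] at this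
        exact (mul_eq_zero.1 this).resolve_left hl')
    have hsq : 5 * d ^ 2 + 5 * f ^ 2 ≤ 5 * (d + f) ^ 2 := by nlinarith [Nat.zero_le (d * f)]
    refine ⟨A ∪ A', Finset.union_subset (hA.trans hs₁) (hA'.trans hs₂), B ∪ B',
      Finset.union_subset hB hB',
      (Finset.card_union_le _ _).trans ((add_le_add hAc hAc').trans hsq),
      (Finset.card_union_le _ _).trans ((add_le_add hBc hBc').trans hsq), ?_⟩
    have h1 : (crossings L M).card ≤ (crossings L₁ M).card + (crossings L₂ M).card := by
      rw [← hu, crossings_union_left]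
      exact Finset.card_union_le _ _
    have h2 : (crossings A B).card + (crossings A' B').card ≤
        (crossings (A ∪ A') (B ∪ B')).card := by
      rw [← Finset.card_union_of_disjoint]
      · exact Finset.card_le_card (Finset.union_subset
          (crossings_mono Finset.subset_union_left Finset.subset_union_left)
          (crossings_mono Finset.subset_union_right Finset.subset_union_right))
      · rw [Finset.disjoint_left]
        intro q hq hq'
        exact (Finset.mem_filter.1 (hA' (mem_crossings.1 hq').1.1)).2
          (Finset.mem_filter.1 (hA (mem_crossings.1 hq).1.1)).2
    rw [← hc]
    nlinarith [Nat.zero_le (f * L₁.card), Nat.zero_le (d * L₂.card)]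

end NullLine

namespace NullLine

open MvPolynomial

variable {F : Type*} [Field F]

/-- A subfamily that saturates many lines of `M`, selected greedily. -/
theorem exists_saturating (L M : Finset (NullLine F)) {d D : ℕ} (hdD : d < D)
    (hD : ∀ l ∈ L, D ≤ (M.filter fun m => l.Meets m).card) :
    ∃ X ⊆ L, X.card * (D - d) ≤ M.card * (d + 1) ∧ ∀ l ∈ L, l ∉ X →
      d < (M.filter fun m => l.Meets m ∧ d < (X.filter fun l' => l'.Meets m).card).card := by
  let Φ : Finset (NullLine F) → ℕ := fun X =>
    ∑ m ∈ M, min (X.filter fun l' => l'.Meets m).card (d + 1)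
  have hne : (L.powerset.filter fun X => X.card * (D - d) ≤ Φ X).Nonempty :=
    ⟨∅, by simp [Φ]⟩
  obtain ⟨X, hX, hmax⟩ := Finset.exists_max_image _ Finset.card hne
  obtain ⟨hXL, hXΦ⟩ := Finset.mem_filter.1 hX
  rw [Finset.mem_powerset] at hXL
  refine ⟨X, hXL, hXΦ.trans ?_, fun l hl hlX => ?_⟩
  · rw [← smul_eq_mul M.card]
    exact Finset.sum_le_card_nsmul _ _ _ fun m _ => min_le_right _ _
  have hstep : Φ (insert l X) = Φ X +
      (M.filter fun m => l.Meets m ∧ ¬ d < (X.filter fun l' => l'.Meets m).card).card := by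
    rw [Finset.card_filter, ← Finset.sum_add_distrib]
    refine Finset.sum_congr rfl fun m _ => ?_
    rw [Finset.filter_insert]
    by_cases h1 : l.Meets m
    · rw [if_pos h1, Finset.card_insert_of_notMem fun h => hlX (Finset.mem_filter.1 h).1]
      split_ifs with h2
      · omega
      · simp only [h1, true_and, not_not] at h2
        omega
    · simp [h1]
  have hnot : ¬ (insert l X).card * (D - d) ≤ Φ (insert l X) := by
    intro h
    have := hmax (insert l X) (Finset.mem_filter.2
      ⟨Finset.mem_powerset.2 (Finset.insert_subset hl hXL), h⟩)
    rw [Finset.card_insert_of_notMem hlX] at this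
    omega
  rw [hstep, Finset.card_insert_of_notMem hlX, add_mul, one_mul] at hnot
  have hsplit := Finset.card_filter_add_card_filter_not (s := M.filter fun m => l.Meets m)
    (fun m => d < (X.filter fun l' => l'.Meets m).card)
  rw [Finset.filter_filter, Finset.filter_filter] at hsplit
  have := hD l hl
  omega

theorem exists_surface {L M : Finset (NullLine F)} {k d D : ℕ} (h : Admissible L M k)
    (hdD : d < D) (hD : ∀ l ∈ L, D ≤ (M.filter fun m => l.Meets m).card)
    (hM : 6 * (M.card * (d + 1)) < (D - d) * ((d + 2) * (d + 3))) :
    ∃ P : MvPolynomial (Fin 3) F, P ≠ 0 ∧ P.totalDegree ≤ d ∧ ∀ l ∈ L, l.restrict P = 0 := by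
  obtain ⟨X, hXL, hXc, hX⟩ := exists_saturating L M hdD hD
  have hXd : 6 * X.card < (d + 2) * (d + 3) := by
    apply lt_of_mul_lt_mul_left _ (Nat.zero_le (D - d))
    nlinarith
  have hchoose : 6 * (d + 3).choose 3 = (d + 1) * ((d + 2) * (d + 3)) := by
    have := Nat.descFactorial_eq_factorial_mul_choose (d + 3) 3
    rw [show (3 : ℕ).factorial = 6 by rfl] at this
    rw [← this]
    simp [Nat.descFactorial]
  obtain ⟨P, hP0, hPd, hP⟩ := exists_vanishing (X := X) (d := d) (by nlinarith)
  refine ⟨P, hP0, hPd, fun l hl => ?_⟩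
  by_cases hlX : l ∈ X
  · exact hP l hlX
  by_contra hne
  have hsat : ∀ m ∈ M, d < (X.filter fun l' => l'.Meets m).card → m.restrict P = 0 := by
    intro m hm hd
    by_contra hne
    have := card_le_totalDegree (S := X.filter fun l' => l'.Meets m) (m := m)
      (fun a ha b hb => h.skew_left a (hXL (Finset.mem_filter.1 ha).1)
        b (hXL (Finset.mem_filter.1 hb).1)) hne fun a ha => by
          obtain ⟨ha, t, ht⟩ := Finset.mem_filter.1 ha
          exact ⟨t, ht, by rw [← ht]; exact eval_eq_zero_of_restrict (hP a ha) t⟩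
    omega
  have h1 := hX l hl hlX
  have h2 := card_le_totalDegree
    (S := M.filter fun m => l.Meets m ∧ d < (X.filter fun l' => l'.Meets m).card) (m := l)
    (fun a ha b hb => h.skew_right a (Finset.mem_filter.1 ha).1
        b (Finset.mem_filter.1 hb).1) hne fun a ha => by
          obtain ⟨ha, ⟨t, ht⟩, hd⟩ := Finset.mem_filter.1 ha
          exact ⟨t, ht.symm, by rw [ht]; exact eval_eq_zero_of_restrict (hsat a ha hd) t⟩
  omega

/-- The incidence bound for null lines. -/
theorem card_crossings_le {k : ℕ} (s : ℕ) : ∀ {L M : Finset (NullLine F)},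
    Admissible L M k → (∀ n : ℕ, 0 < n → n ≤ s → (n : F) ≠ 0) →
    L.card ≤ s ^ 2 → M.card ≤ s ^ 2 →
    (crossings L M).card ≤ 45 * s ^ 3 + 2 * k * s ^ 2 := by
  induction s using Nat.strong_induction_on with
  | _ s ih =>
  intro L M h hchar hLs hMs
  by_cases hs : s < 6
  · have h1 : (crossings L M).card ≤ L.card * M.card := by
      rw [← Finset.card_product]
      exact Finset.card_filter_le _ _
    have h2 := Nat.mul_le_mul hLs hMs
    have h3 : s ^ 2 * s ^ 2 ≤ 6 * s ^ 3 := by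
      calc s ^ 2 * s ^ 2 = s * s ^ 3 := by ring
        _ ≤ 6 * s ^ 3 := Nat.mul_le_mul_right _ hs.le
    nlinarith [Nat.zero_le (2 * k * s ^ 2), Nat.zero_le (s ^ 3)]
  obtain ⟨d, hd1, hd2⟩ : ∃ d, 6 * d ≤ s ∧ s ≤ 6 * d + 5 := ⟨s / 6, by omega, by omega⟩
  set L₁ := L.filter fun l => 37 * s ≤ (M.filter fun m => l.Meets m).card with hL₁
  set L₂ := L.filter fun l => ¬ 37 * s ≤ (M.filter fun m => l.Meets m).card with hL₂
  have hu : L₁ ∪ L₂ = L := Finset.filter_union_filter_not_eq _ _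
  have hs₁ : L₁ ⊆ L := Finset.filter_subset _ _
  have hs₂ : L₂ ⊆ L := Finset.filter_subset _ _
  have hI : (crossings L M).card ≤ (crossings L₁ M).card + (crossings L₂ M).card := by
    rw [← hu, crossings_union_left]
    exact Finset.card_union_le _ _
  have hI₂ : (crossings L₂ M).card ≤ 37 * s * L₂.card := by
    refine Finset.card_le_mul_of_fibers_fst (fun q hq => (mem_crossings.1 hq).1.1)
      fun l hl S hS => ?_
    refine le_trans (Finset.card_le_card fun m hm => ?_)
      (not_le.1 (Finset.mem_filter.1 hl).2).le
    have := mem_crossings.1 (hS m hm)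
    exact Finset.mem_filter.2 ⟨this.1.2, this.2⟩
  have hA := h.mono hs₁ (Finset.Subset.refl M)
  have hineq : 6 * (M.card * (d + 1)) < (37 * s - d) * ((d + 2) * (d + 3)) := by
    calc 6 * (M.card * (d + 1)) ≤ 6 * (s ^ 2 * (d + 1)) := by gcongr
      _ = 6 * s * (s * (d + 1)) := by ring
      _ ≤ 36 * (d + 3) * (s * (d + 1)) := Nat.mul_le_mul_right _ (by omega)
      _ = (36 * s) * ((d + 1) * (d + 3)) := by ring
      _ < (36 * s) * ((d + 2) * (d + 3)) := by gcongr <;> omega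
      _ ≤ (37 * s - d) * ((d + 2) * (d + 3)) := by gcongr; omega
  obtain ⟨P, hP0, hPd, hP⟩ := exists_surface hA (d := d) (D := 37 * s) (by omega)
    (fun l hl => (Finset.mem_filter.1 hl).2) hineq
  obtain ⟨L', hL', M', hM', hLc, hMc, hI₁⟩ := card_crossings_le_of_surface hP0
    (fun n hn hn' => hchar n hn (by omega)) hA hP
  have h5 : 5 * P.totalDegree ^ 2 ≤ (3 * d) ^ 2 := by nlinarith
  have hrec := ih (3 * d) (by omega) (hA.mono hL' hM')
    (fun n hn hn' => hchar n hn (by omega)) (hLc.trans h5) (hMc.trans h5)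
  have hc₁ := (Finset.card_le_card hs₁).trans hLs
  have hc₂ := (Finset.card_le_card hs₂).trans hLs
  have e1 : 37 * s * L₂.card ≤ 37 * s ^ 3 := by
    calc 37 * s * L₂.card ≤ 37 * s * s ^ 2 := Nat.mul_le_mul_left _ hc₂
      _ = 37 * s ^ 3 := by ring
  have e2 : (5 * P.totalDegree + k) * L₁.card ≤ (5 * d + k) * s ^ 2 :=
    Nat.mul_le_mul (by omega) hc₁
  have e3 : 7 * P.totalDegree * M.card ≤ 7 * d * s ^ 2 := Nat.mul_le_mul (by omega) hMs
  have e4 : 12 * d * s ^ 2 ≤ 2 * s ^ 3 := by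
    calc 12 * d * s ^ 2 ≤ 2 * s * s ^ 2 := Nat.mul_le_mul_right _ (by omega)
      _ = 2 * s ^ 3 := by ring
  have e5 : 8 * (3 * d) ^ 3 ≤ s ^ 3 := by
    calc 8 * (3 * d) ^ 3 = (6 * d) ^ 3 := by ring
      _ ≤ s ^ 3 := Nat.pow_le_pow_left hd1 3
  have e6 : 2 * k * (3 * d) ^ 2 ≤ k * s ^ 2 := by
    have : 4 * (3 * d) ^ 2 ≤ s ^ 2 := by
      calc 4 * (3 * d) ^ 2 = (6 * d) ^ 2 := by ring
        _ ≤ s ^ 2 := Nat.pow_le_pow_left hd1 2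
    calc 2 * k * (3 * d) ^ 2 = k * (2 * (3 * d) ^ 2) := by ring
      _ ≤ k * s ^ 2 := Nat.mul_le_mul_left _ (by omega)
  nlinarith

end NullLine

/-- The Cauchy–Schwarz bound for the number of pairs in the same fibre of a map. -/
theorem Finset.card_sq_le_card_mul_collisions {α β : Type*} {T : Finset α} {Y : Finset β}
    {f : α → β} (hf : ∀ a ∈ T, f a ∈ Y) :
    T.card ^ 2 ≤ Y.card * ((T ×ˢ T).filter fun q => f q.1 = f q.2).card := by
  have h1 := Finset.card_eq_sum_card_fiberwise hf
  have h2 := Finset.card_eq_sum_card_fiberwise (s := (T ×ˢ T).filter fun q => f q.1 = f q.2)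
    (f := fun q => f q.1) (t := Y) (fun q hq => by
      rw [mem_coe, Finset.mem_filter, Finset.mem_product] at hq
      exact hf _ hq.1.1)
  rw [h1, h2]
  refine sq_sum_le_card_mul_sum_sq.trans (Nat.mul_le_mul_left _ (Finset.sum_le_sum fun y _ => ?_))
  rw [sq, ← Finset.card_product]
  refine Finset.card_le_card fun q hq => ?_
  simp only [Finset.mem_filter, Finset.mem_product] at hq ⊢
  exact ⟨⟨⟨hq.1.1, hq.2.1⟩, hq.1.2.trans hq.2.2.symm⟩, hq.1.2⟩

namespace NullLine

section Field

variable {K : Type*} [Field K]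

theorem Meets.relation {l m : NullLine K} (h : l.Meets m) :
    l.x * m.y - m.x * l.y = (l.x * l.y - l.z) - (m.x * m.y - m.z) := by
  obtain ⟨t, ht⟩ := h
  obtain ⟨h1, h2⟩ := point_eq_iff.1 ht
  linear_combination (- (l.x + m.x)) * h1 + h2

theorem meets_of_symplectic {l m : NullLine K} (hx : l.x ≠ m.x)
    (h : l.x * m.y - m.x * l.y = (l.x * l.y - l.z) - (m.x * m.y - m.z)) : l.Meets m := by
  apply meets_of_relation hx 0
  simp only [point, Matrix.cons_val]
  linear_combination h

end Field

variable {F : Type*} [Field F]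

theorem ratFunc_quadratic_eq_zero {a b c : F}
    (h : RatFunc.C a + RatFunc.X * RatFunc.C b + RatFunc.X ^ 2 * RatFunc.C c = 0) :
    a = 0 ∧ b = 0 ∧ c = 0 := by
  have h1 : (Polynomial.C a + Polynomial.X * Polynomial.C b + Polynomial.X ^ 2 * Polynomial.C c :
      Polynomial F) = 0 := by
    apply RatFunc.algebraMap_injective F
    simp only [map_add, map_mul, map_pow, map_zero, RatFunc.algebraMap_C, RatFunc.algebraMap_X]
    exact h
  have h2 := fun n => congrArg (fun p => Polynomial.coeff p n) h1
  refine ⟨?_, ?_, ?_⟩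
  · simpa [Polynomial.coeff_X, Polynomial.coeff_C, Polynomial.coeff_X_pow] using h2 0
  · simpa [Polynomial.coeff_X, Polynomial.coeff_C, Polynomial.coeff_X_pow] using h2 1
  · simpa [Polynomial.coeff_X, Polynomial.coeff_C, Polynomial.coeff_X_pow] using h2 2

/-- The null line over `F(τ)` attached to a triple `(a, b, c₁)`. -/
noncomputable def leftLine (p : F × F × F) : NullLine (RatFunc F) where
  x := RatFunc.C p.2.1
  y := RatFunc.C p.2.2
  z := RatFunc.C p.2.1 * RatFunc.C p.2.2 -
    (RatFunc.C p.1 + RatFunc.X * RatFunc.C p.2.1 + RatFunc.X ^ 2 * RatFunc.C p.2.2)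

/-- The null line over `F(τ)` attached to a triple `(a₁, b₁, c)`. -/
noncomputable def rightLine (q : F × F × F) : NullLine (RatFunc F) where
  x := -RatFunc.X ^ 2 - RatFunc.C q.2.1
  y := RatFunc.X - RatFunc.C q.2.2
  z := (-RatFunc.X ^ 2 - RatFunc.C q.2.1) * (RatFunc.X - RatFunc.C q.2.2) - RatFunc.C q.1

theorem leftLine_skew {p q : F × F × F} (h : (leftLine p).Meets (leftLine q)) : p = q := by
  have h1 := h.relation
  simp only [leftLine] at h1
  obtain ⟨ha, hb, hc⟩ := ratFunc_quadratic_eq_zero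
    (a := p.1 - q.1 - (p.2.1 * q.2.2 - q.2.1 * p.2.2)) (b := p.2.1 - q.2.1)
    (c := p.2.2 - q.2.2) (by
      simp only [map_sub, map_mul]
      linear_combination - h1)
  have hb' := sub_eq_zero.1 hb
  have hc' := sub_eq_zero.1 hc
  refine Prod.ext ?_ (Prod.ext hb' hc')
  rw [hb', hc'] at ha
  linear_combination ha

theorem rightLine_skew {p q : F × F × F} (h : (rightLine p).Meets (rightLine q)) : p = q := by
  have h1 := h.relation
  simp only [rightLine] at h1
  obtain ⟨ha, hb, hc⟩ := ratFunc_quadratic_eq_zero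
    (a := q.1 - p.1 + (p.2.1 * q.2.2 - q.2.1 * p.2.2)) (b := q.2.1 - p.2.1)
    (c := q.2.2 - p.2.2) (by
      simp only [map_sub, map_add, map_mul]
      linear_combination h1)
  have hb' := sub_eq_zero.1 hb
  have hc' := sub_eq_zero.1 hc
  refine Prod.ext ?_ (Prod.ext hb'.symm hc'.symm)
  rw [hb', hc'] at ha
  linear_combination - ha

theorem leftLine_injective : Function.Injective (leftLine (F := F)) := fun _ _ h =>
  leftLine_skew (h ▸ ⟨0, rfl⟩)

theorem rightLine_injective : Function.Injective (rightLine (F := F)) := fun _ _ h =>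
  rightLine_skew (h ▸ ⟨0, rfl⟩)

theorem leftLine_slope_ne (p q : F × F × F) : (leftLine p).x ≠ (rightLine q).x := by
  intro h
  simp only [leftLine, rightLine] at h
  obtain ⟨-, -, hc⟩ := ratFunc_quadratic_eq_zero (a := p.2.1 + q.2.1) (b := (0 : F)) (c := (1 : F))
    (by
      simp only [map_add, map_zero, map_one]
      linear_combination h)
  exact one_ne_zero hc

theorem leftLine_meets_rightLine {p q : F × F × F} :
    (leftLine p).Meets (rightLine q) ↔ p.1 + p.2.1 * q.2.2 = q.1 + q.2.1 * p.2.2 := by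
  constructor
  · intro h
    have h1 := h.relation
    simp only [leftLine, rightLine] at h1
    apply RatFunc.C_injective
    simp only [map_add, map_mul]
    linear_combination - h1
  · intro h
    apply meets_of_symplectic (leftLine_slope_ne p q)
    have h1 := congrArg (RatFunc.C (K := F)) h
    simp only [map_add, map_mul] at h1
    simp only [leftLine, rightLine]
    linear_combination - h1

theorem admissible_lines (A B C : Finset F) {k : ℕ} (hB : B.card ≤ k) (hC : C.card ≤ k) :
    Admissible ((A ×ˢ B ×ˢ C).image leftLine) ((A ×ˢ B ×ˢ C).image rightLine) k where
  skew_left l hl l' hl' h := by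
    obtain ⟨p, -, rfl⟩ := Finset.mem_image.1 hl
    obtain ⟨q, -, rfl⟩ := Finset.mem_image.1 hl'
    rw [leftLine_skew h]
  skew_right l hl l' hl' h := by
    obtain ⟨p, -, rfl⟩ := Finset.mem_image.1 hl
    obtain ⟨q, -, rfl⟩ := Finset.mem_image.1 hl'
    rw [rightLine_skew h]
  slope_ne l hl m hm := by
    obtain ⟨p, -, rfl⟩ := Finset.mem_image.1 hl
    obtain ⟨q, -, rfl⟩ := Finset.mem_image.1 hm
    exact leftLine_slope_ne p q
  codegree l hl l' hl' hne := by
    obtain ⟨⟨a₁, b₁, c₁⟩, -, rfl⟩ := Finset.mem_image.1 hl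
    obtain ⟨⟨a₂, b₂, c₂⟩, -, rfl⟩ := Finset.mem_image.1 hl'
    rw [Finset.filter_image]
    refine Finset.card_image_le.trans ?_
    simp only [leftLine_meets_rightLine]
    by_cases hc : c₁ = c₂
    · have hb : b₁ ≠ b₂ ∨ a₁ ≠ a₂ := by
        by_contra! h
        exact hne (by rw [hc, h.1, h.2])
      refine (Finset.card_le_card_of_injOn (fun q => q.2.1) (t := B) ?_ ?_).trans hB
      · intro q hq
        simp only [Finset.coe_filter, Finset.mem_product, Set.mem_ofPred_eq] at hq
        exact hq.1.2.1
      · rintro ⟨a, b, c⟩ hq ⟨a', b', c'⟩ hq' hbb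
        simp only [Finset.coe_filter, Finset.mem_product, Set.mem_ofPred_eq] at hq hq' hbb
        obtain ⟨-, h1, h2⟩ := hq
        obtain ⟨-, h1', h2'⟩ := hq'
        subst hc hbb
        have hbc : ∀ x : F, a₁ + b₁ * x = a₂ + b₂ * x → b₁ ≠ b₂ := by
          rintro x hx rfl
          exact hb.elim (fun h => h rfl) fun h => h (add_right_cancel hx)
        have hne' := hbc c (h1.trans h2.symm)
        have hcc : c = c' := by
          apply mul_left_cancel₀ (sub_ne_zero.2 hne')
          linear_combination h1 - h2 - h1' + h2'
        subst hcc
        have : a = a' := by linear_combination h1' - h1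
        rw [this]
    · refine (Finset.card_le_card_of_injOn (fun q => q.2.2) (t := C) ?_ ?_).trans hC
      · intro q hq
        simp only [Finset.coe_filter, Finset.mem_product, Set.mem_ofPred_eq] at hq
        exact hq.1.2.2
      · rintro ⟨a, b, c⟩ hq ⟨a', b', c'⟩ hq' hcc
        simp only [Finset.coe_filter, Finset.mem_product, Set.mem_ofPred_eq] at hq hq' hcc
        obtain ⟨-, h1, h2⟩ := hq
        obtain ⟨-, h1', h2'⟩ := hq'
        subst hcc
        have hbb : b = b' := by
          apply mul_left_cancel₀ (sub_ne_zero.2 hc)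
          linear_combination h1' - h2' - h1 + h2
        subst hbb
        have : a = a' := by linear_combination h1' - h1
        rw [this]

/-- The number of solutions of `a + b c = a₁ + b₁ c₁` is bounded by an incidence count. -/
theorem card_collisions_le (A B C : Finset F) :
    (((A ×ˢ B ×ˢ C) ×ˢ (A ×ˢ B ×ˢ C)).filter fun q =>
      q.1.1 + q.1.2.1 * q.1.2.2 = q.2.1 + q.2.2.1 * q.2.2.2).card ≤
    (crossings ((A ×ˢ B ×ˢ C).image leftLine) ((A ×ˢ B ×ˢ C).image rightLine)).card := by
  refine Finset.card_le_card_of_injOn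
    (fun q => (leftLine (q.1.1, q.1.2.1, q.2.2.2), rightLine (q.2.1, q.2.2.1, q.1.2.2))) ?_ ?_
  · intro q hq
    simp only [Finset.coe_filter, Finset.mem_product, Set.mem_ofPred_eq] at hq
    obtain ⟨⟨⟨h1, h2, h3⟩, h4, h5, h6⟩, h⟩ := hq
    exact mem_crossings.2 ⟨⟨Finset.mem_image_of_mem _ (by simp [h1, h2, h6]),
      Finset.mem_image_of_mem _ (by simp [h3, h4, h5])⟩, leftLine_meets_rightLine.2 h⟩
  · rintro ⟨⟨a, b, c⟩, a', b', c'⟩ - ⟨⟨d, e, f⟩, d', e', f'⟩ - h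
    obtain ⟨h1, h2⟩ := Prod.ext_iff.1 h
    have h3 := leftLine_injective h1
    have h4 := rightLine_injective h2
    simp only [Prod.mk.injEq] at h3 h4 ⊢
    tauto

end NullLine

/-- The energy estimate behind the sum-product type bound. -/
theorem card_sq_le_card_add_mul {F : Type*} [Field F] (A B C : Finset F) {s k : ℕ}
    (hchar : ∀ n : ℕ, 0 < n → n ≤ s → (n : F) ≠ 0) (hB : B.card ≤ k) (hC : C.card ≤ k)
    (hs : A.card * B.card * C.card ≤ s ^ 2) :
    (A.card * B.card * C.card) ^ 2 ≤ (A + B * C).card * (45 * s ^ 3 + 2 * k * s ^ 2) := by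
  have hcard : (A ×ˢ B ×ˢ C).card = A.card * B.card * C.card := by
    rw [Finset.card_product, Finset.card_product, mul_assoc]
  have h1 := Finset.card_sq_le_card_mul_collisions (T := A ×ˢ B ×ˢ C) (Y := A + B * C)
    (f := fun q => q.1 + q.2.1 * q.2.2) (by
      intro q hq
      simp only [Finset.mem_product] at hq
      exact Finset.add_mem_add hq.1 (Finset.mul_mem_mul hq.2.1 hq.2.2))
  rw [hcard] at h1
  refine h1.trans (Nat.mul_le_mul_left _ ((NullLine.card_collisions_le A B C).trans
    (NullLine.card_crossings_le s (NullLine.admissible_lines A B C hB hC) ?_ ?_ ?_)))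
  · intro n hn hn' h0
    refine hchar n hn hn' (RatFunc.C_injective ?_)
    rw [map_natCast, map_zero, h0]
  · exact Finset.card_image_le.trans (hcard.trans_le hs)
  · exact Finset.card_image_le.trans (hcard.trans_le hs)

theorem Finset.exists_mem_ne_zero {F : Type*} [Zero F] {B : Finset F} (hB : B.Nonempty)
    (hB' : B ≠ {0}) : ∃ b ∈ B, b ≠ 0 := by
  by_contra! h
  exact hB' (Finset.eq_singleton_iff_nonempty_unique_mem.2 ⟨hB, h⟩)

theorem card_le_card_add_mul {F : Type*} [Field F] {A B C : Finset F} (hA : A.Nonempty)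
    (hC : C.Nonempty) (hC' : C ≠ {0}) : B.card ≤ (A + B * C).card := by
  obtain ⟨a, ha⟩ := hA
  obtain ⟨c, hc, hc0⟩ := Finset.exists_mem_ne_zero hC hC'
  refine Finset.card_le_card_of_injOn (fun b => a + b * c)
    (fun b hb => Finset.add_mem_add ha (Finset.mul_mem_mul hb hc)) fun b _ b' _ h => ?_
  exact mul_right_cancel₀ hc0 (add_left_cancel h)

theorem stmt_10 :
    ∃ c C : ℝ, 0 < c ∧ 0 < C ∧
      ∀ (F : Type) [Field F] (A B C' : Finset F),
        A.Nonempty → B.Nonempty → C'.Nonempty →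
        A ≠ {0} → B ≠ {0} → C' ≠ {0} →
        (∀ p : ℕ, p.Prime → CharP F p →
          ((A.card : ℝ) * B.card * C'.card) ≤ c * (p : ℝ) ^ 2) →
        C * ((A.card : ℝ) * B.card * C'.card) ^ ((1 : ℝ) / 2) ≤ ((A + B * C').card : ℝ) := by
  refine ⟨1 / 16, 1 / 400, by norm_num, by norm_num, ?_⟩
  intro F _ A B C hA hB hC _ hB' hC' hp
  rw [← Real.sqrt_eq_rpow]
  have hσB : B.card ≤ (A + B * C).card := card_le_card_add_mul hA hC hC'
  have hσC : C.card ≤ (A + B * C).card := by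
    rw [mul_comm B C]
    exact card_le_card_add_mul hA hB hB'
  set σ := (A + B * C).card
  obtain ⟨N, hN⟩ : ∃ N, N = A.card * B.card * C.card := ⟨_, rfl⟩
  have hNr : (A.card : ℝ) * B.card * C.card = N := by rw [hN]; push_cast; ring
  rw [hNr] at hp ⊢
  have hN1 : 1 ≤ N := by
    rw [hN]
    exact Nat.mul_pos (Nat.mul_pos hA.card_pos hB.card_pos) hC.card_pos
  obtain ⟨k, hk⟩ : ∃ k, k = max B.card C.card := ⟨_, rfl⟩
  have hkσ : k ≤ σ := hk ▸ max_le hσB hσC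
  set r := Real.sqrt N with hr
  have hr2 : r ^ 2 = N := Real.sq_sqrt (Nat.cast_nonneg _)
  have hr1 : 1 ≤ r := by
    rw [hr]
    exact Real.one_le_sqrt.2 (by exact_mod_cast hN1)
  have hkσ' : (k : ℝ) ≤ σ := by exact_mod_cast hkσ
  rcases le_or_gt r k with hrk | hrk
  · nlinarith
  obtain ⟨s, hs⟩ : ∃ s, s = Nat.sqrt N + 1 := ⟨_, rfl⟩
  have hNs : N ≤ s ^ 2 := by
    rw [hs, sq]
    exact (Nat.lt_succ_sqrt N).le
  have hsr : (s : ℝ) ≤ 2 * r := by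
    have h1 : (Nat.sqrt N : ℝ) ≤ r := Real.nat_sqrt_le_real_sqrt
    rw [hs]
    push_cast
    linarith
  have hks : (k : ℝ) ≤ s := by
    have h1 : (N : ℝ) ≤ (s : ℝ) ^ 2 := by exact_mod_cast hNs
    exact hrk.le.trans (Real.sqrt_le_iff.2 ⟨Nat.cast_nonneg _, h1⟩)
  have hchar : ∀ n : ℕ, 0 < n → n ≤ s → (n : F) ≠ 0 := by
    intro n hn hns h0
    obtain ⟨p, hcp⟩ := CharP.exists F
    have hdvd := (CharP.cast_eq_zero_iff F p n).1 h0
    have hpn := Nat.le_of_dvd hn hdvd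
    rcases CharP.char_is_prime_or_zero F p with hpp | rfl
    · have h1 := hp p hpp hcp
      have h2 : (p : ℝ) ≤ s := by exact_mod_cast hpn.trans hns
      have h3 : (0 : ℝ) < p := by exact_mod_cast hpp.pos
      nlinarith
    · exact hn.ne' (Nat.eq_zero_of_zero_dvd hdvd)
  have hmain := card_sq_le_card_add_mul A B C hchar (hk ▸ le_max_left _ _) (hk ▸ le_max_right _ _)
    (hN ▸ hNs)
  rw [← hN] at hmain
  have hmain' : (N : ℝ) ^ 2 ≤ σ * (45 * (s : ℝ) ^ 3 + 2 * k * (s : ℝ) ^ 2) := by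
    exact_mod_cast hmain
  have hs3 : 45 * (s : ℝ) ^ 3 + 2 * k * (s : ℝ) ^ 2 ≤ 400 * r ^ 3 := by
    have h1 : (s : ℝ) ^ 3 ≤ (2 * r) ^ 3 := pow_le_pow_left₀ (Nat.cast_nonneg _) hsr 3
    have h2 : 2 * (k : ℝ) * (s : ℝ) ^ 2 ≤ 2 * s * (s : ℝ) ^ 2 := by gcongr
    nlinarith [pow_pos (lt_of_lt_of_le one_pos hr1) 3]
  have h4 : r ^ 3 * r ≤ r ^ 3 * (400 * σ) := by
    calc r ^ 3 * r = (N : ℝ) ^ 2 := by rw [← hr2]; ring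
      _ ≤ σ * (400 * r ^ 3) := hmain'.trans (mul_le_mul_of_nonneg_left hs3 (Nat.cast_nonneg _))
      _ = r ^ 3 * (400 * σ) := by ring
  have h5 := le_of_mul_le_mul_left h4 (pow_pos (lt_of_lt_of_le one_pos hr1) 3)
  linarith
end
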